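/- Let $(M,g)$ be a smooth Riemannian manifold of dimension $n\ge 3$ with Levi-Civita connection $\nabla$ and curvature tensor $R(X,Y)Z=\nabla_X\nabla_YZ-\nabla_Y\nabla_XZ-\nabla_{[X,Y]}Z$. For $X$ tangent to $M$ let $X^h$ and $X^v$ be its horizontal lift (with respect to $\nabla$) and its vertical lift to the tangent bundle $TM$. Let $a,b,c\in\mathbb R$ with $a>0$ and $\alpha:=a(a+c)-b^2>0$, and let $G=a\,g^s+b\,g^h+c\,g^v$ be the $g$-natural Riemannian metric on $TM$ given by $$G(X^h,Y^h)=(a+c)\,g(X,Y),\qquad G(X^h,Y^v)=G(X^v,Y^h)=b\,g(X,Y),\qquad G(X^v,Y^v)=a\,g(X,Y).$$ Call a Riemannian manifold $(N,h)$, with Levi-Civita connection $\nabla$ and curvature tensor $R$, pseudo-symmetric if there is a smooth $1$-form $\alpha_2$ on $N$, with $h$-dual vector field $\alpha_2^\sharp$, such that $$(\nabla_WR)(X,Y)Z=2\alpha_2(W)R(X,Y)Z+\alpha_2(X)R(W,Y)Z+\alpha_2(Y)R(X,W)Z+\alpha_2(Z)R(X,Y)W+h(R(X,Y)Z,W)\,\alpha_2^\sharp$$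 for all vector fields $X,Y,Z,W$ on $N$, and flat if its curvature tensor vanishes identically. Then $(TM,G)$ is pseudo-symmetric if and only if $(M,g)$ is flat; moreover, in this case $(TM,G)$ is flat. -/

import Mathlib

open scoped Manifold ContDiff
open Bundle

set_option maxSynthPendingDepth 3

noncomputable section

section Coordinates

/-! Riemannian geometry in a coordinate domain.  `γ x u v` are the metric coefficients at the
coordinate point `x`, evaluated on the coordinate vectors `u`, `v`. -/

variable {E : Type*} [NormedAddCommGroup E] [NormedSpace ℝ E]

/-- The bilinear form `u, v ↦ B (P u) (Q v)`. -/
def pullForm {V U : Type*} [TopologicalSpace V] [AddCommGroup V] [Module ℝ V]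
    [TopologicalSpace U] [AddCommGroup U] [Module ℝ U]
    (B : V →L[ℝ] V →L[ℝ] ℝ) (P Q : U →L[ℝ] V) : U →L[ℝ] U →L[ℝ] ℝ :=
  (ContinuousLinearMap.precomp ℝ Q).comp (B.comp P)

@[simp] theorem pullForm_apply {V U : Type*} [TopologicalSpace V] [AddCommGroup V] [Module ℝ V]
    [TopologicalSpace U] [AddCommGroup U] [Module ℝ U]
    (B : V →L[ℝ] V →L[ℝ] ℝ) (P Q : U →L[ℝ] V) (u v : U) :
    pullForm B P Q u v = B (P u) (Q v) := rfl

/-- The Christoffel symbols of the first kind of `γ` at `x`: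
`u, v, w ↦ ½ (∂_u γ(v, w) + ∂_v γ(u, w) - ∂_w γ(u, v))`. -/
def christoffelFirst (γ : E → E →L[ℝ] E →L[ℝ] ℝ) (x : E) :
    E →L[ℝ] E →L[ℝ] E →L[ℝ] ℝ :=
  (1 / 2 : ℝ) • (fderiv ℝ γ x + (fderiv ℝ γ x).flip
    - (ContinuousLinearMap.flipₗᵢ ℝ E E ℝ).toContinuousLinearEquiv.toContinuousLinearMap.comp
        (fderiv ℝ γ x).flip)

theorem christoffelFirst_apply (γ : E → E →L[ℝ] E →L[ℝ] ℝ) (x u v w : E) :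
    christoffelFirst γ x u v w =
      1 / 2 * (fderiv ℝ γ x u v w + fderiv ℝ γ x v u w - fderiv ℝ γ x w u v) := rfl

/-- The Christoffel symbols (of the second kind) of the Levi-Civita connection of `γ` at `x`:
`Γ(u, v)` is the vector with `γ(Γ(u, v), w) = ½ (∂_u γ(v, w) + ∂_v γ(u, w) - ∂_w γ(u, v))`
for all `w`. -/
def christoffel (γ : E → E →L[ℝ] E →L[ℝ] ℝ) (x : E) : E →L[ℝ] E →L[ℝ] E :=
  (ContinuousLinearMap.compL ℝ E (E →L[ℝ] ℝ) E (γ x).inverse).comp (christoffelFirst γ x)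

/-- The curvature tensor `R(u, v)w = ∇_u ∇_v w - ∇_v ∇_u w` of `γ` at `x`, for `u`, `v`, `w`
extended to constant (hence commuting) coordinate vector fields. -/
def coordCurvature (γ : E → E →L[ℝ] E →L[ℝ] ℝ) (x u v w : E) : E :=
  fderiv ℝ (christoffel γ) x u v w - fderiv ℝ (christoffel γ) x v u w
    + christoffel γ x u (christoffel γ x v w) - christoffel γ x v (christoffel γ x u w)

/-- The covariant derivative `(∇_z R)(u, v)w` of the curvature tensor of `γ` at `x`. -/
def coordCovDerivCurvature (γ : E → E →L[ℝ] E →L[ℝ] ℝ) (x z u v w : E) : E :=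
  fderiv ℝ (fun x' => coordCurvature γ x' u v w) x z
    + christoffel γ x z (coordCurvature γ x u v w)
    - coordCurvature γ x (christoffel γ x z u) v w
    - coordCurvature γ x u (christoffel γ x z v) w
    - coordCurvature γ x u v (christoffel γ x z w)

end Coordinates

section Riemannian

/-! Tensors of a manifold without boundary `N` with a metric `h`.  The tangent space
`TangentSpace I p` is, by definition, the model vector space `E`, a vector being identified with
its components in the preferred chart `extChartAt I p` at `p`.  Tensors at `p` are therefore
computed in that chart. -/

variable {E : Type*} [NormedAddCommGroup E] [NormedSpace ℝ E]
  {H : Type*} [TopologicalSpace H] (I : ModelWithCorners ℝ E H)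
  {N : Type*} [TopologicalSpace N] [ChartedSpace H N] [IsManifold I 1 N]

/-- The coefficients of `h` in the chart `extChartAt I p`, as a function on the model space.
Here `(trivializationAt E (TangentSpace I) p).symmL ℝ q` is the differential of the inverse chart,
mapping coordinate vectors to tangent vectors at `q`. -/
def metricInChart (h : ∀ q : N, TangentSpace I q →L[ℝ] TangentSpace I q →L[ℝ] ℝ) (p : N)
    (x : E) : E →L[ℝ] E →L[ℝ] ℝ :=
  pullForm (h ((extChartAt I p).symm x))
    ((trivializationAt E (TangentSpace I) p).symmL ℝ ((extChartAt I p).symm x))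
    ((trivializationAt E (TangentSpace I) p).symmL ℝ ((extChartAt I p).symm x))

/-- The Christoffel symbols of `h` at `p`, in the chart `extChartAt I p`. -/
def christoffelAt (h : ∀ q : N, TangentSpace I q →L[ℝ] TangentSpace I q →L[ℝ] ℝ) (p : N) :
    E →L[ℝ] E →L[ℝ] E :=
  christoffel (metricInChart I h p) (extChartAt I p p)

/-- The curvature tensor `R(u, v)w` of `(N, h)` at `p`. -/
def curvatureAt (h : ∀ q : N, TangentSpace I q →L[ℝ] TangentSpace I q →L[ℝ] ℝ) (p : N)
    (u v w : TangentSpace I p) : TangentSpace I p :=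
  coordCurvature (E := E) (metricInChart I h p) (extChartAt I p p) u v w

/-- The covariant derivative `(∇_z R)(u, v)w` of the curvature tensor of `(N, h)` at `p`. -/
def covDerivCurvatureAt (h : ∀ q : N, TangentSpace I q →L[ℝ] TangentSpace I q →L[ℝ] ℝ) (p : N)
    (z u v w : TangentSpace I p) : TangentSpace I p :=
  coordCovDerivCurvature (E := E) (metricInChart I h p) (extChartAt I p p) z u v w

/-- `(N, h)` is flat: its curvature tensor vanishes identically. -/
def IsFlat (h : ∀ q : N, TangentSpace I q →L[ℝ] TangentSpace I q →L[ℝ] ℝ) : Prop :=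
  ∀ (p : N) (u v w : TangentSpace I p), curvatureAt I h p u v w = 0

/-- The vector `θ^♯` at `p` that is `h`-dual to a covector `θ`: `h(θ^♯, w) = θ(w)`. -/
def sharp (h : ∀ q : N, TangentSpace I q →L[ℝ] TangentSpace I q →L[ℝ] ℝ) (p : N)
    (θ : TangentSpace I p →L[ℝ] ℝ) : TangentSpace I p :=
  (h p).inverse θ

/-- `(N, h)` is pseudo-symmetric: there is a smooth 1-form `θ` on `N` with
`(∇_W R)(X, Y)Z = 2 θ(W) R(X, Y)Z + θ(X) R(W, Y)Z + θ(Y) R(X, W)Z + θ(Z) R(X, Y)W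
  + h(R(X, Y)Z, W) θ^♯`. -/
def IsPseudoSymmetric
    (h : ∀ q : N, TangentSpace I q →L[ℝ] TangentSpace I q →L[ℝ] ℝ) : Prop :=
  ∃ θ : ∀ p : N, TangentSpace I p →L[ℝ] ℝ,
    ContMDiff I (I.prod 𝓘(ℝ, E →L[ℝ] ℝ)) ∞
      (fun p => TotalSpace.mk' (E →L[ℝ] ℝ) (E := fun q : N => TangentSpace I q →L[ℝ] ℝ) p (θ p)) ∧
    ∀ (p : N) (W X Y Z : TangentSpace I p),
      covDerivCurvatureAt I h p W X Y Z =
        (2 * θ p W) • curvatureAt I h p X Y Z + θ p X • curvatureAt I h p W Y Z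
          + θ p Y • curvatureAt I h p X W Z + θ p Z • curvatureAt I h p X Y W
          + h p (curvatureAt I h p X Y Z) W • sharp I h p (θ p)

end Riemannian

section TangentBundleMetrics

/-! Lifts of a metric `g` on `M` to the tangent bundle `TM`.  The preferred chart of `TM` at `v` is
the chart `(xⁱ, yⁱ)` induced by the preferred chart `(xⁱ)` of `M` at the base point of `v`; so
`TangentSpace I.tangent v` is `E × E`, the pair `(ξ, η)` being `ξⁱ ∂/∂xⁱ + ηⁱ ∂/∂yⁱ`. -/

variable {E : Type*} [NormedAddCommGroup E] [NormedSpace ℝ E]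
  {H : Type*} [TopologicalSpace H] (I : ModelWithCorners ℝ E H)
  {M : Type*} [TopologicalSpace M] [ChartedSpace H M] [IsManifold I 1 M]

/-- The horizontal lift `Xʰ = Xⁱ (∂/∂xⁱ - yᵃ Γᵃᵢʲ ∂/∂yʲ)` of `X` to the point `v = (x, y)`. -/
def horizontalLift (g : ∀ q : M, TangentSpace I q →L[ℝ] TangentSpace I q →L[ℝ] ℝ)
    (v : TangentBundle I M) (X : TangentSpace I v.proj) : TangentSpace I.tangent v :=
  ((X, -christoffelAt I g v.proj X v.snd) : E × E)

/-- The vertical lift `Xᵛ = Xⁱ ∂/∂yⁱ` of `X` to the point `v`. -/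
def verticalLift (v : TangentBundle I M) (X : TangentSpace I v.proj) :
    TangentSpace I.tangent v :=
  ((0, X) : E × E)

/-- The vector `X` of the horizontal part `Xʰ` of a tangent vector of `TM` at `v`; it is the
image of the tangent vector under the differential of the projection `TM → M`. -/
def horizontalPart (v : TangentBundle I M) :
    TangentSpace I.tangent v →L[ℝ] TangentSpace I v.proj :=
  ContinuousLinearMap.fst ℝ E E

/-- `horizontalPart` is the differential of the projection `TM → M`. -/
theorem horizontalPart_eq_mfderiv [I.Boundaryless] (v : TangentBundle I M) :
    horizontalPart I v = mfderiv I.tangent I (TotalSpace.proj : TangentBundle I M → M) v := by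
  have hd : MDifferentiableAt I.tangent I (TotalSpace.proj : TangentBundle I M → M) v :=
    (contMDiff_proj (n := 1) (TangentSpace I) v).mdifferentiableAt (by simp)
  rw [hd.mfderiv, I.tangent.range_eq_univ, fderivWithin_univ]
  have key : writtenInExtChartAt I.tangent I v (TotalSpace.proj : TangentBundle I M → M)
      =ᶠ[nhds (extChartAt I.tangent v v)] Prod.fst := by
    filter_upwards [extChartAt_target_mem_nhds (I := I.tangent) v] with y hy
    have h2 : (extChartAt I v.proj) ((extChartAt I.tangent v).symm y).proj =
        (extChartAt I.tangent v ((extChartAt I.tangent v).symm y)).1 := by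
      simp [extChartAt, TangentBundle.coe_chartAt_fst]
    simp only [writtenInExtChartAt, Function.comp]
    rw [h2, (extChartAt I.tangent v).right_inv hy]
  rw [key.fderiv_eq]
  exact fderiv_fst.symm

/-- The vector `Y` of the vertical part `Yᵛ` of a tangent vector of `TM` at `v`. -/
def verticalPart (g : ∀ q : M, TangentSpace I q →L[ℝ] TangentSpace I q →L[ℝ] ℝ)
    (v : TangentBundle I M) : TangentSpace I.tangent v →L[ℝ] TangentSpace I v.proj :=
  (ContinuousLinearMap.snd ℝ E E +
    ((christoffelAt I g v.proj).flip v.snd).comp (ContinuousLinearMap.fst ℝ E E) : E × E →L[ℝ] E)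

/-- The decomposition `ξ = hξ + vξ` of the tangent vectors of `TM`. -/
theorem horizontalLift_add_verticalLift
    (g : ∀ q : M, TangentSpace I q →L[ℝ] TangentSpace I q →L[ℝ] ℝ)
    (v : TangentBundle I M) (ξ : TangentSpace I.tangent v) :
    horizontalLift I g v (horizontalPart I v ξ) + verticalLift I v (verticalPart I g v ξ) = ξ :=
  Prod.ext (add_zero (ξ : E × E).1) (by
    change -christoffelAt I g v.proj (ξ : E × E).1 v.snd +
      ((ξ : E × E).2 + christoffelAt I g v.proj (ξ : E × E).1 v.snd) = (ξ : E × E).2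
    abel)

@[simp] theorem horizontalPart_horizontalLift
    (g : ∀ q : M, TangentSpace I q →L[ℝ] TangentSpace I q →L[ℝ] ℝ)
    (v : TangentBundle I M) (X : TangentSpace I v.proj) :
    horizontalPart I v (horizontalLift I g v X) = X := rfl

@[simp] theorem horizontalPart_verticalLift (v : TangentBundle I M) (X : TangentSpace I v.proj) :
    horizontalPart I v (verticalLift I v X) = 0 := rfl

@[simp] theorem verticalPart_horizontalLift
    (g : ∀ q : M, TangentSpace I q →L[ℝ] TangentSpace I q →L[ℝ] ℝ)
    (v : TangentBundle I M) (X : TangentSpace I v.proj) :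
    verticalPart I g v (horizontalLift I g v X) = 0 :=
  neg_add_cancel (christoffelAt I g v.proj X v.snd)

@[simp] theorem verticalPart_verticalLift
    (g : ∀ q : M, TangentSpace I q →L[ℝ] TangentSpace I q →L[ℝ] ℝ)
    (v : TangentBundle I M) (X : TangentSpace I v.proj) :
    verticalPart I g v (verticalLift I v X) = X := by
  have h : ∀ Y y : E, Y + christoffelAt I g v.proj 0 y = Y := fun Y y => by simp
  exact h X v.snd

/-- The Sasaki lift `gˢ`. -/
def sasakiLift (g : ∀ q : M, TangentSpace I q →L[ℝ] TangentSpace I q →L[ℝ] ℝ)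
    (v : TangentBundle I M) :
    TangentSpace I.tangent v →L[ℝ] TangentSpace I.tangent v →L[ℝ] ℝ :=
  pullForm (g v.proj) (horizontalPart I v) (horizontalPart I v) +
    pullForm (g v.proj) (verticalPart I g v) (verticalPart I g v)

/-- The horizontal lift `gʰ` of the metric. -/
def metricHorizontalLift (g : ∀ q : M, TangentSpace I q →L[ℝ] TangentSpace I q →L[ℝ] ℝ)
    (v : TangentBundle I M) :
    TangentSpace I.tangent v →L[ℝ] TangentSpace I.tangent v →L[ℝ] ℝ :=
  pullForm (g v.proj) (horizontalPart I v) (verticalPart I g v) +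
    pullForm (g v.proj) (verticalPart I g v) (horizontalPart I v)

/-- The vertical lift `gᵛ` of the metric. -/
def metricVerticalLift (g : ∀ q : M, TangentSpace I q →L[ℝ] TangentSpace I q →L[ℝ] ℝ)
    (v : TangentBundle I M) :
    TangentSpace I.tangent v →L[ℝ] TangentSpace I.tangent v →L[ℝ] ℝ :=
  pullForm (g v.proj) (horizontalPart I v) (horizontalPart I v)

/-- The `g`-natural metric `G = a gˢ + b gʰ + c gᵛ` on `TM`. -/
def gNaturalMetric (g : ∀ q : M, TangentSpace I q →L[ℝ] TangentSpace I q →L[ℝ] ℝ) (a b c : ℝ)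
    (v : TangentBundle I M) :
    TangentSpace I.tangent v →L[ℝ] TangentSpace I.tangent v →L[ℝ] ℝ :=
  a • sasakiLift I g v + b • metricHorizontalLift I g v + c • metricVerticalLift I g v

/-- The values of `G` on horizontal and vertical lifts. -/
theorem gNaturalMetric_lifts (g : ∀ q : M, TangentSpace I q →L[ℝ] TangentSpace I q →L[ℝ] ℝ)
    (a b c : ℝ) (v : TangentBundle I M) (X Y : TangentSpace I v.proj) :
    gNaturalMetric I g a b c v (horizontalLift I g v X) (horizontalLift I g v Y)
        = (a + c) * g v.proj X Y ∧
      gNaturalMetric I g a b c v (horizontalLift I g v X) (verticalLift I v Y)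
        = b * g v.proj X Y ∧
      gNaturalMetric I g a b c v (verticalLift I v X) (horizontalLift I g v Y)
        = b * g v.proj X Y ∧
      gNaturalMetric I g a b c v (verticalLift I v X) (verticalLift I v Y)
        = a * g v.proj X Y := by
  simp [gNaturalMetric, sasakiLift, metricHorizontalLift, metricVerticalLift, add_mul]

end TangentBundleMetrics

end

noncomputable section

section CoordinateGeometry

set_option linter.unusedSectionVars false

open Filter Topology

variable {E : Type*} [NormedAddCommGroup E] [NormedSpace ℝ E]

/-- `γ` is a smooth Riemannian metric on the coordinate domain `U`. -/
structure IsMetricOn (γ : E → E →L[ℝ] E →L[ℝ] ℝ) (U : Set E) : Prop where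
  isOpen : IsOpen U
  contDiffOn : ContDiffOn ℝ ∞ γ U
  symm : ∀ x ∈ U, ∀ u v, γ x u v = γ x v u
  pos : ∀ x ∈ U, ∀ u, u ≠ 0 → 0 < γ x u u

theorem christoffel_congr {γ γ' : E → E →L[ℝ] E →L[ℝ] ℝ} {x : E} (h : γ =ᶠ[𝓝 x] γ') :
    christoffel γ =ᶠ[𝓝 x] christoffel γ' := by
  filter_upwards [h.eventuallyEq_nhds] with z hz
  simp only [christoffel, christoffelFirst, hz.fderiv_eq, hz.eq_of_nhds]

theorem coordCurvature_congr {γ γ' : E → E →L[ℝ] E →L[ℝ] ℝ} {x : E} (h : γ =ᶠ[𝓝 x] γ') :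
    coordCurvature γ =ᶠ[𝓝 x] coordCurvature γ' := by
  filter_upwards [h.eventuallyEq_nhds] with z hz
  have hc := christoffel_congr hz
  funext u v w
  simp only [coordCurvature, hc.fderiv_eq, hc.eq_of_nhds]

theorem coordCovDerivCurvature_congr {γ γ' : E → E →L[ℝ] E →L[ℝ] ℝ} {x : E}
    (h : γ =ᶠ[𝓝 x] γ') : coordCovDerivCurvature γ x = coordCovDerivCurvature γ' x := by
  have hc := christoffel_congr h
  have hR := coordCurvature_congr h
  funext z u v w
  have : (fun x' => coordCurvature γ x' u v w) =ᶠ[𝓝 x] fun x' => coordCurvature γ' x' u v w := by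
    filter_upwards [hR] with y hy using by rw [hy]
  simp only [coordCovDerivCurvature, this.fderiv_eq, hc.eq_of_nhds, hR.eq_of_nhds]

theorem coordCovDerivCurvature_eq_zero {γ : E → E →L[ℝ] E →L[ℝ] ℝ} {x : E}
    (h : ∀ᶠ y in 𝓝 x, ∀ u v w, coordCurvature γ y u v w = 0) (z u v w : E) :
    coordCovDerivCurvature γ x z u v w = 0 := by
  have h0 := h.self_of_nhds
  have : (fun x' => coordCurvature γ x' u v w) =ᶠ[𝓝 x] fun _ => 0 := by
    filter_upwards [h] with y hy using hy u v w
  simp [coordCovDerivCurvature, this.fderiv_eq, h0]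

theorem coordCurvature_swap (γ : E → E →L[ℝ] E →L[ℝ] ℝ) (x u v w : E) :
    coordCurvature γ x u v w = -coordCurvature γ x v u w := by
  simp only [coordCurvature]; abel

theorem coordCurvature_self (γ : E → E →L[ℝ] E →L[ℝ] ℝ) (x u w : E) :
    coordCurvature γ x u u w = 0 := by
  simp [coordCurvature]

/-- The curvature tensor as a continuous trilinear map. -/
def curvatureCLM (γ : E → E →L[ℝ] E →L[ℝ] ℝ) (x : E) : E →L[ℝ] E →L[ℝ] E →L[ℝ] E :=
  letI comp₂ : E →L[ℝ] E →L[ℝ] E →L[ℝ] E :=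
    ((ContinuousLinearMap.compL ℝ E E E).flip.comp (christoffel γ x)).flip.comp (christoffel γ x)
  fderiv ℝ (christoffel γ) x - (fderiv ℝ (christoffel γ) x).flip + comp₂ - comp₂.flip

theorem curvatureCLM_apply (γ : E → E →L[ℝ] E →L[ℝ] ℝ) (x u v w : E) :
    curvatureCLM γ x u v w = coordCurvature γ x u v w := rfl

variable [FiniteDimensional ℝ E]

theorem isInvertible_of_pos {B : E →L[ℝ] E →L[ℝ] ℝ} (hB : ∀ u, u ≠ 0 → 0 < B u u) :
    B.IsInvertible := by
  have hinj : Function.Injective (B : E →ₗ[ℝ] E →L[ℝ] ℝ) := by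
    rw [← LinearMap.ker_eq_bot, LinearMap.ker_eq_bot']
    intro u hu
    by_contra hne
    have h1 := hB u hne
    have h2 : B u = 0 := hu
    simp [h2] at h1
  have hfr : Module.finrank ℝ E = Module.finrank ℝ (E →L[ℝ] ℝ) := by
    rw [← (LinearMap.toContinuousLinearMap : (E →ₗ[ℝ] ℝ) ≃ₗ[ℝ] _).finrank_eq]
    exact (Subspace.dual_finrank_eq (K := ℝ) (V := E)).symm
  refine ⟨(LinearEquiv.ofInjectiveOfFinrankEq (B : E →ₗ[ℝ] E →L[ℝ] ℝ) hinj
    hfr).toContinuousLinearEquiv, ?_⟩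
  ext u v
  rfl

namespace IsMetricOn

variable {γ : E → E →L[ℝ] E →L[ℝ] ℝ} {U : Set E} (h : IsMetricOn γ U) {x : E} (hx : x ∈ U)
include h hx

theorem mem_nhds : U ∈ 𝓝 x := h.isOpen.mem_nhds hx

theorem contDiffAt : ContDiffAt ℝ ∞ γ x := h.contDiffOn.contDiffAt (h.mem_nhds hx)

theorem isInvertible : (γ x).IsInvertible := isInvertible_of_pos (h.pos x hx)

theorem hasFDerivAt : HasFDerivAt γ (fderiv ℝ γ x) x :=
  ((h.contDiffAt hx).differentiableAt (by simp)).hasFDerivAt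

theorem ext_inner {u v : E} (huv : ∀ w, γ x u w = γ x v w) : u = v := by
  by_contra hne
  have h1 := h.pos x hx (u - v) (sub_ne_zero.2 hne)
  have h2 : γ x (u - v) = 0 := by ext w; simp [huv w]
  simp [h2] at h1

theorem inner_christoffel (u v w : E) :
    γ x (christoffel γ x u v) w = christoffelFirst γ x u v w := by
  have h1 := (h.isInvertible hx).inverse_apply_eq (x := christoffel γ x u v)
    (y := christoffelFirst γ x u v)
  rw [← h1.1 rfl]

theorem fderiv_symm (w u v : E) : fderiv ℝ γ x w u v = fderiv ℝ γ x w v u := by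
  have h0 := h.hasFDerivAt hx
  have h1 : HasFDerivAt (fun y => γ y u v) _ x :=
    (h0.clm_apply (hasFDerivAt_const u x)).clm_apply (hasFDerivAt_const v x)
  have h2 : HasFDerivAt (fun y => γ y v u) _ x :=
    (h0.clm_apply (hasFDerivAt_const v x)).clm_apply (hasFDerivAt_const u x)
  have h3 : (fun y => γ y u v) =ᶠ[𝓝 x] fun y => γ y v u := by
    filter_upwards [h.mem_nhds hx] with y hy using h.symm y hy u v
  have h4 := (h1.congr_of_eventuallyEq h3.symm).unique h2
  simpa using congrArg (fun L => L w) h4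

theorem christoffel_symm (u v : E) : christoffel γ x u v = christoffel γ x v u := by
  refine h.ext_inner hx fun w => ?_
  rw [h.inner_christoffel hx, h.inner_christoffel hx, christoffelFirst_apply,
    christoffelFirst_apply, h.fderiv_symm hx w u v]
  ring

/-- The Levi-Civita connection is metric. -/
theorem fderiv_eq (w u v : E) : fderiv ℝ γ x w u v =
    γ x (christoffel γ x w u) v + γ x u (christoffel γ x w v) := by
  rw [h.symm x hx u, h.inner_christoffel hx, h.inner_christoffel hx, christoffelFirst_apply,
    christoffelFirst_apply, h.fderiv_symm hx w v u, h.fderiv_symm hx v w u,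
    h.fderiv_symm hx u w v]
  ring

/-- Uniqueness of the Levi-Civita connection. -/
theorem christoffel_eq_of_symm_of_metric (T : E → E → E) (hs : ∀ u v, T u v = T v u)
    (hm : ∀ w u v, fderiv ℝ γ x w u v = γ x (T w u) v + γ x u (T w v)) (u v : E) :
    christoffel γ x u v = T u v := by
  refine h.ext_inner hx fun w => ?_
  rw [h.inner_christoffel hx, christoffelFirst_apply, hm u v w, hm v u w, hm w u v, hs v u,
    hs w u, hs w v, h.symm x hx v (T u w)]
  ring

theorem contDiffAt_christoffel : ContDiffAt ℝ ∞ (christoffel γ) x := by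
  have := FiniteDimensional.complete ℝ E
  have h0 := h.contDiffAt hx
  have h1 : ContDiffAt ℝ ∞ (fderiv ℝ γ) x := h0.fderiv_right (m := ∞) (by simp)
  have h2 : ContDiffAt ℝ ∞ (fun y => (γ y).inverse) x :=
    ((h.isInvertible hx).contDiffAt_map_inverse).comp x h0
  have h3 : ContDiffAt ℝ ∞ (christoffelFirst γ) x := by
    unfold christoffelFirst
    have hf : ContDiffAt ℝ ∞ (fun y => (fderiv ℝ γ y).flip) x :=
      ((ContinuousLinearMap.flipₗᵢ ℝ E E
        (E →L[ℝ] ℝ)).toContinuousLinearEquiv.contDiff.contDiffAt).comp x h1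
    have hff : ContDiffAt ℝ ∞ (fun y => (ContinuousLinearMap.flipₗᵢ ℝ E E
        ℝ).toContinuousLinearEquiv.toContinuousLinearMap.comp (fderiv ℝ γ y).flip) x :=
      contDiffAt_const.clm_comp hf
    have hs := (h1.add hf).sub hff
    exact hs.const_smul (1 / 2 : ℝ)
  unfold christoffel
  exact ((ContinuousLinearMap.compL ℝ E (E →L[ℝ] ℝ) E).contDiff.contDiffAt.comp x h2).clm_comp h3

theorem hasFDerivAt_christoffel :
    HasFDerivAt (christoffel γ) (fderiv ℝ (christoffel γ) x) x :=
  ((h.contDiffAt_christoffel hx).differentiableAt (by simp)).hasFDerivAt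

theorem fderiv_christoffel_symm (w u v : E) :
    fderiv ℝ (christoffel γ) x w u v = fderiv ℝ (christoffel γ) x w v u := by
  have h0 := h.hasFDerivAt_christoffel hx
  have h1 : HasFDerivAt (fun y => christoffel γ y u v) _ x :=
    (h0.clm_apply (hasFDerivAt_const u x)).clm_apply (hasFDerivAt_const v x)
  have h2 : HasFDerivAt (fun y => christoffel γ y v u) _ x :=
    (h0.clm_apply (hasFDerivAt_const v x)).clm_apply (hasFDerivAt_const u x)
  have h3 : (fun y => christoffel γ y u v) =ᶠ[𝓝 x] fun y => christoffel γ y v u := by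
    filter_upwards [h.mem_nhds hx] with y hy using h.christoffel_symm hy u v
  have h4 := (h1.congr_of_eventuallyEq h3.symm).unique h2
  simpa using congrArg (fun L => L w) h4

/-- The first Bianchi identity. -/
theorem bianchi (u v w : E) :
    coordCurvature γ x u v w + coordCurvature γ x v w u + coordCurvature γ x w u v = 0 := by
  simp only [coordCurvature]
  rw [h.fderiv_christoffel_symm hx u w v, h.fderiv_christoffel_symm hx v w u,
    h.fderiv_christoffel_symm hx w v u, h.christoffel_symm hx w v, h.christoffel_symm hx w u,
    h.christoffel_symm hx v u]
  abel

/-- The curvature operators are skew-adjoint. -/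
theorem inner_curvature_skew (u v w z : E) :
    γ x (coordCurvature γ x u v w) z = -γ x w (coordCurvature γ x u v z) := by
  have hγ' := ((h.contDiffAt hx).fderiv_right (m := ∞) (by simp)).differentiableAt
    (by simp) |>.hasFDerivAt
  have key : ∀ u v : E, fderiv ℝ (fderiv ℝ γ) x u v w z =
      fderiv ℝ γ x u (christoffel γ x v w) z + γ x (fderiv ℝ (christoffel γ) x u v w) z
        + (fderiv ℝ γ x u w (christoffel γ x v z) + γ x w (fderiv ℝ (christoffel γ) x u v z)) := by
    intro u v
    have h0 := h.hasFDerivAt hx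
    have hc := h.hasFDerivAt_christoffel hx
    have hcon : ∀ e : E, HasFDerivAt (fun _ : E => e) (0 : E →L[ℝ] E) x :=
      fun e => hasFDerivAt_const e x
    have h1 := ((hγ'.clm_apply (hcon v)).clm_apply (hcon w)).clm_apply (hcon z)
    have h2 := ((h0.clm_apply ((hc.clm_apply (hcon v)).clm_apply (hcon w))).clm_apply
      (hcon z)).add
      ((h0.clm_apply (hcon w)).clm_apply ((hc.clm_apply (hcon v)).clm_apply (hcon z)))
    have h3 : (fun y => fderiv ℝ γ y v w z) =ᶠ[𝓝 x]
        fun y => γ y (christoffel γ y v w) z + γ y w (christoffel γ y v z) := by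
      filter_upwards [h.mem_nhds hx] with y hy using h.fderiv_eq hy v w z
    have h4 := (h1.congr_of_eventuallyEq h3.symm).unique h2
    have h5 := congrArg (fun L => L u) h4
    simp only [add_apply, ContinuousLinearMap.flip_apply,
      ContinuousLinearMap.comp_apply, zero_add,
      ContinuousLinearMap.comp_zero] at h5
    rw [h5]; ring
  have hsymm : fderiv ℝ (fderiv ℝ γ) x u v = fderiv ℝ (fderiv ℝ γ) x v u :=
    ((h.contDiffAt hx).isSymmSndFDerivAt (by simpa using ENat.LEInfty.out)) u v
  have h1 := key u v
  have h2 := key v u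
  rw [hsymm, h2] at h1
  simp only [h.fderiv_eq hx] at h1
  simp only [coordCurvature, map_add, map_sub, add_apply,
    sub_apply]
  linear_combination -h1

/-- The pair symmetry of the curvature tensor. -/
theorem inner_curvature_pair_symm (u v w z : E) :
    γ x (coordCurvature γ x u v w) z = γ x (coordCurvature γ x w z u) v := by
  have hB : ∀ u v w z, γ x (coordCurvature γ x u v w) z + γ x (coordCurvature γ x v w u) z
      + γ x (coordCurvature γ x w u v) z = 0 := fun u v w z => by
    have := congrArg (fun e => γ x e z) (h.bianchi hx u v w)
    simpa using this
  have hS : ∀ u v w z, γ x (coordCurvature γ x u v w) z = -γ x (coordCurvature γ x u v z) w :=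
    fun u v w z => by rw [h.inner_curvature_skew hx, h.symm x hx w]
  have hA : ∀ u v w z, γ x (coordCurvature γ x u v w) z = -γ x (coordCurvature γ x v u w) z :=
    fun u v w z => by rw [coordCurvature_swap]; simp
  have e1 := hB u v w z
  have e2 := hB v w z u
  have e3 := hB w z u v
  have e4 := hB z u v w
  linarith [hS u v w z, hS v w u z, hS w u v z, hS w z u v, hS z u w v, hS u w z v, hS v z u w,
    hA u v w z, hA w u v z, hA w z u v, hA v z u w, hA z v w u, hA w u z v, hS w u z v]

end IsMetricOn

end CoordinateGeometry

section LocalIsometry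

set_option linter.unusedSectionVars false

open Filter Topology

variable {E : Type*} [NormedAddCommGroup E] [NormedSpace ℝ E] [FiniteDimensional ℝ E]

/-- Near `x`, the map `φ` is smooth and pulls the metric `γ'` on `U'` back to the metric `γ` on
`U`. -/
def IsLocalIsometryAt (γ γ' : E → E →L[ℝ] E →L[ℝ] ℝ) (U U' : Set E) (φ : E → E) (x : E) : Prop :=
  ∀ᶠ y in 𝓝 x, y ∈ U ∧ φ y ∈ U' ∧ ContDiffAt ℝ ∞ φ y ∧
    ∀ u v, γ y u v = γ' (φ y) (fderiv ℝ φ y u) (fderiv ℝ φ y v)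

variable {γ γ' : E → E →L[ℝ] E →L[ℝ] ℝ} {U U' : Set E} {φ : E → E} {x : E}

theorem IsLocalIsometryAt.eventually (hφ : IsLocalIsometryAt γ γ' U U' φ x) :
    ∀ᶠ y in 𝓝 x, IsLocalIsometryAt γ γ' U U' φ y :=
  eventually_eventually_nhds.2 hφ

theorem IsLocalIsometryAt.injective (h : IsMetricOn γ U) (hφ : IsLocalIsometryAt γ γ' U U' φ x) :
    Function.Injective (fderiv ℝ φ x) := by
  obtain ⟨hx, -, -, hiso⟩ := hφ.self_of_nhds
  refine (injective_iff_map_eq_zero _).2 fun u hu => ?_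
  by_contra hne
  have := h.pos x hx u hne
  rw [hiso, hu] at this
  simp at this

theorem ContDiffAt.hasFDerivAt_fderiv (hφ : ContDiffAt ℝ ∞ φ x) :
    HasFDerivAt (fderiv ℝ φ) (fderiv ℝ (fderiv ℝ φ) x) x :=
  ((hφ.fderiv_right (m := ∞) (by simp)).differentiableAt (by simp)).hasFDerivAt

/-- The transformation law of the Christoffel symbols. -/
theorem IsLocalIsometryAt.map_christoffel (h : IsMetricOn γ U) (h' : IsMetricOn γ' U')
    (hφ : IsLocalIsometryAt γ γ' U U' φ x) (u v : E) :
    fderiv ℝ φ x (christoffel γ x u v) = fderiv ℝ (fderiv ℝ φ) x u v +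
      christoffel γ' (φ x) (fderiv ℝ φ x u) (fderiv ℝ φ x v) := by
  obtain ⟨hx, hx', hsm, -⟩ := hφ.self_of_nhds
  have hsurj : Function.Surjective (fderiv ℝ φ x) :=
    (LinearMap.injective_iff_surjective (f := (fderiv ℝ φ x : E →ₗ[ℝ] E))).1 (hφ.injective h)
  choose S hS using hsurj
  have hsymm : ∀ u v, fderiv ℝ (fderiv ℝ φ) x u v = fderiv ℝ (fderiv ℝ φ) x v u := fun u v =>
    (hsm.isSymmSndFDerivAt (by simpa using ENat.LEInfty.out)) u v
  have key := h.christoffel_eq_of_symm_of_metric hx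
    (fun u v => S (fderiv ℝ (fderiv ℝ φ) x u v +
      christoffel γ' (φ x) (fderiv ℝ φ x u) (fderiv ℝ φ x v)))
    (fun u v => by rw [hsymm, h'.christoffel_symm hx']) ?_ u v
  · rw [key, hS]
  intro w u v
  have hd := (hsm.differentiableAt (by simp)).hasFDerivAt
  have hd2 := hsm.hasFDerivAt_fderiv
  have hcon : ∀ e : E, HasFDerivAt (fun _ : E => e) (0 : E →L[ℝ] E) x :=
    fun e => hasFDerivAt_const e x
  have h1 := ((h.hasFDerivAt hx).clm_apply (hcon u)).clm_apply (hcon v)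
  have h2 := (((h'.hasFDerivAt hx').comp x hd).clm_apply (hd2.clm_apply (hcon u))).clm_apply
    (hd2.clm_apply (hcon v))
  have h3 : (fun y => γ y u v) =ᶠ[𝓝 x]
      fun y => (γ' ∘ φ) y (fderiv ℝ φ y u) (fderiv ℝ φ y v) := by
    filter_upwards [hφ] with y hy using hy.2.2.2 u v
  have h4 := congrArg (fun L => L w) ((h1.congr_of_eventuallyEq h3.symm).unique h2)
  simp only [add_apply, ContinuousLinearMap.flip_apply, ContinuousLinearMap.comp_apply, zero_add,
    ContinuousLinearMap.comp_zero, Function.comp_apply] at h4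
  rw [h4, hφ.self_of_nhds.2.2.2, hφ.self_of_nhds.2.2.2, hS, hS, h'.fderiv_eq hx']
  simp only [map_add, add_apply]
  ring

/-- The curvature tensor is natural under local isometries. -/
theorem IsLocalIsometryAt.map_curvature (h : IsMetricOn γ U) (h' : IsMetricOn γ' U')
    (hφ : IsLocalIsometryAt γ γ' U U' φ x) (u v w : E) :
    fderiv ℝ φ x (coordCurvature γ x u v w) =
      coordCurvature γ' (φ x) (fderiv ℝ φ x u) (fderiv ℝ φ x v) (fderiv ℝ φ x w) := by
  obtain ⟨hx, hx', hsm, -⟩ := hφ.self_of_nhds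
  have hsmd : ContDiffAt ℝ ∞ (fderiv ℝ φ) x := hsm.fderiv_right (by simp)
  have hsymm₃ : fderiv ℝ (fderiv ℝ (fderiv ℝ φ)) x u v = fderiv ℝ (fderiv ℝ (fderiv ℝ φ)) x v u :=
    (hsmd.isSymmSndFDerivAt (by simpa using ENat.LEInfty.out)) u v
  have hsymm : fderiv ℝ (fderiv ℝ φ) x u v = fderiv ℝ (fderiv ℝ φ) x v u :=
    (hsm.isSymmSndFDerivAt (by simpa using ENat.LEInfty.out)) u v
  have key : ∀ u v, fderiv ℝ (fderiv ℝ φ) x u (christoffel γ x v w)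
      + fderiv ℝ φ x (fderiv ℝ (christoffel γ) x u v w) =
      fderiv ℝ (fderiv ℝ (fderiv ℝ φ)) x u v w
      + (fderiv ℝ (christoffel γ') (φ x) (fderiv ℝ φ x u) (fderiv ℝ φ x v) (fderiv ℝ φ x w)
        + christoffel γ' (φ x) (fderiv ℝ (fderiv ℝ φ) x u v) (fderiv ℝ φ x w)
        + christoffel γ' (φ x) (fderiv ℝ φ x v) (fderiv ℝ (fderiv ℝ φ) x u w)) := by
    intro u v
    have hd := (hsm.differentiableAt (by simp)).hasFDerivAt
    have hd2 := hsm.hasFDerivAt_fderiv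
    have hd3 : HasFDerivAt (fderiv ℝ (fderiv ℝ φ)) (fderiv ℝ (fderiv ℝ (fderiv ℝ φ)) x) x :=
      ((hsmd.fderiv_right (m := ∞) (by simp)).differentiableAt (by simp)).hasFDerivAt
    have hcon : ∀ e : E, HasFDerivAt (fun _ : E => e) (0 : E →L[ℝ] E) x :=
      fun e => hasFDerivAt_const e x
    have h1 := hd2.clm_apply
      (((h.hasFDerivAt_christoffel hx).clm_apply (hcon v)).clm_apply (hcon w))
    have h2 := ((hd3.clm_apply (hcon v)).clm_apply (hcon w)).add
      ((((h'.hasFDerivAt_christoffel hx').comp x hd).clm_apply (hd2.clm_apply (hcon v))).clm_apply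
        (hd2.clm_apply (hcon w)))
    have h3 : (fun y => fderiv ℝ φ y (christoffel γ y v w)) =ᶠ[𝓝 x]
        fun y => fderiv ℝ (fderiv ℝ φ) y v w +
          (christoffel γ' ∘ φ) y (fderiv ℝ φ y v) (fderiv ℝ φ y w) := by
      filter_upwards [hφ.eventually] with y hy using hy.map_christoffel h h' v w
    have h4 := congrArg (fun L => L u) ((h1.congr_of_eventuallyEq h3.symm).unique h2)
    simp only [add_apply, ContinuousLinearMap.flip_apply, ContinuousLinearMap.comp_apply, zero_add,
      ContinuousLinearMap.comp_zero, Function.comp_apply] at h4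
    rw [add_comm, h4]
    abel
  have e1 := key u v
  have e2 := key v u
  rw [hsymm₃, hsymm] at e1
  simp only [coordCurvature, map_add, map_sub, hφ.map_christoffel h h']
  linear_combination (norm := module) e1 - e2

end LocalIsometry

section LiftedMetric

set_option linter.unusedSectionVars false

open Filter Topology

variable {E : Type*} [NormedAddCommGroup E] [NormedSpace ℝ E]

/-- The vertical part `(ξ, η) ↦ η + Γ(ξ, y)` at the point `z = (x, y)` of the coordinate tangent
bundle. -/
def coordVerticalPart (γ : E → E →L[ℝ] E →L[ℝ] ℝ) (z : E × E) : E × E →L[ℝ] E :=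
  ContinuousLinearMap.snd ℝ E E +
    ((christoffel γ z.1).flip z.2).comp (ContinuousLinearMap.fst ℝ E E)

theorem coordVerticalPart_apply (γ : E → E →L[ℝ] E →L[ℝ] ℝ) (z u : E × E) :
    coordVerticalPart γ z u = u.2 + christoffel γ z.1 u.1 z.2 := rfl

/-- The `g`-natural metric `a gˢ + b gʰ + c gᵛ` in the coordinates `(x, y)` of the tangent bundle. -/
def liftMetric (γ : E → E →L[ℝ] E →L[ℝ] ℝ) (a b c : ℝ) (z : E × E) :
    E × E →L[ℝ] E × E →L[ℝ] ℝ :=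
  letI P := ContinuousLinearMap.fst ℝ E E
  letI K := coordVerticalPart γ z
  a • (pullForm (γ z.1) P P + pullForm (γ z.1) K K)
    + b • (pullForm (γ z.1) P K + pullForm (γ z.1) K P) + c • pullForm (γ z.1) P P

theorem liftMetric_apply (γ : E → E →L[ℝ] E →L[ℝ] ℝ) (a b c : ℝ) (z u v : E × E) :
    liftMetric γ a b c z u v =
      γ z.1 ((a + c) • u.1 + b • coordVerticalPart γ z u) v.1
        + γ z.1 (b • u.1 + a • coordVerticalPart γ z u) (coordVerticalPart γ z v) := by
  simp [liftMetric]
  ring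

/-- The horizontal defect of the Levi-Civita connection of the lifted metric; `κ = (2α)⁻¹`. -/
def liftHorizontal (γ : E → E →L[ℝ] E →L[ℝ] ℝ) (a b κ : ℝ) (z u v : E × E) : E :=
  -(a * b * κ) • (coordCurvature γ z.1 u.1 z.2 v.1 + coordCurvature γ z.1 v.1 z.2 u.1)
    - (a ^ 2 * κ) • (coordCurvature γ z.1 (coordVerticalPart γ z v) z.2 u.1
      + coordCurvature γ z.1 (coordVerticalPart γ z u) z.2 v.1)

/-- The vertical defect of the Levi-Civita connection of the lifted metric; `κ = (2α)⁻¹`. -/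
def liftVertical (γ : E → E →L[ℝ] E →L[ℝ] ℝ) (a b c κ : ℝ) (z u v : E × E) : E :=
  (2 * b ^ 2 * κ) • coordCurvature γ z.1 u.1 z.2 v.1
    - (a * (a + c) * κ) • coordCurvature γ z.1 u.1 v.1 z.2
    + (a * b * κ) • (coordCurvature γ z.1 (coordVerticalPart γ z v) z.2 u.1
      + coordCurvature γ z.1 (coordVerticalPart γ z u) z.2 v.1)

/-- The Christoffel symbols of the lifted metric in the coordinates `(x, y)`; `κ = (2α)⁻¹`. -/
def liftChristoffel (γ : E → E →L[ℝ] E →L[ℝ] ℝ) (a b c κ : ℝ) (z u v : E × E) : E × E :=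
  (christoffel γ z.1 u.1 v.1 + liftHorizontal γ a b κ z u v,
    fderiv ℝ (christoffel γ) z.1 u.1 v.1 z.2 + christoffel γ z.1 v.1 u.2
      + christoffel γ z.1 u.1 (coordVerticalPart γ z v) + liftVertical γ a b c κ z u v
      - christoffel γ z.1 (christoffel γ z.1 u.1 v.1 + liftHorizontal γ a b κ z u v) z.2)

theorem coordVerticalPart_liftChristoffel (γ : E → E →L[ℝ] E →L[ℝ] ℝ) (a b c κ : ℝ)
    (z u v : E × E) : coordVerticalPart γ z (liftChristoffel γ a b c κ z u v) =
      fderiv ℝ (christoffel γ) z.1 u.1 v.1 z.2 + christoffel γ z.1 v.1 u.2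
      + christoffel γ z.1 u.1 (coordVerticalPart γ z v) + liftVertical γ a b c κ z u v := by
  rw [coordVerticalPart_apply]
  exact sub_add_cancel _ _

variable [FiniteDimensional ℝ E] {γ : E → E →L[ℝ] E →L[ℝ] ℝ} {U : Set E} {a b c : ℝ}

namespace IsMetricOn

theorem lift (h : IsMetricOn γ U) (ha : 0 < a) (hα : 0 < a * (a + c) - b ^ 2) :
    IsMetricOn (liftMetric γ a b c) (U ×ˢ Set.univ) where
  isOpen := h.isOpen.prod isOpen_univ
  contDiffOn := by
    intro z hz
    refine ContDiffAt.contDiffWithinAt ?_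
    have hγ : ContDiffAt ℝ ∞ (fun z : E × E => γ z.1) z :=
      (h.contDiffAt hz.1).comp z contDiffAt_fst
    have hΓ : ContDiffAt ℝ ∞ (fun z : E × E => christoffel γ z.1) z :=
      (h.contDiffAt_christoffel hz.1).comp z contDiffAt_fst
    have hP : ContDiffAt ℝ ∞ (fun _ : E × E => ContinuousLinearMap.fst ℝ E E) z :=
      contDiffAt_const
    have hK : ContDiffAt ℝ ∞ (fun z : E × E => coordVerticalPart γ z) z := by
      unfold coordVerticalPart
      have hf : ContDiffAt ℝ ∞ (fun z : E × E => (christoffel γ z.1).flip) z :=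
        ((ContinuousLinearMap.flipₗᵢ ℝ E E
          E).toContinuousLinearEquiv.contDiff.contDiffAt).comp z hΓ
      exact contDiffAt_const.add ((hf.clm_apply contDiffAt_snd).clm_comp hP)
    have hpull : ∀ {P Q : E × E → (E × E →L[ℝ] E)}, ContDiffAt ℝ ∞ P z → ContDiffAt ℝ ∞ Q z →
        ContDiffAt ℝ ∞ (fun z => pullForm (γ z.1) (P z) (Q z)) z := by
      intro P Q hP hQ
      have h1 : ContDiffAt ℝ ∞ (fun z =>
          (ContinuousLinearMap.compL ℝ (E × E) E ℝ).flip (Q z)) z :=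
        ((ContinuousLinearMap.compL ℝ (E × E) E ℝ).flip.contDiff.contDiffAt).comp z hQ
      exact h1.clm_comp (hγ.clm_comp hP)
    have h1 := ((hpull hP hP).add (hpull hK hK)).const_smul a
    have h2 := ((hpull hP hK).add (hpull hK hP)).const_smul b
    have h3 := (hpull hP hP).const_smul c
    exact (h1.add h2).add h3
  symm z hz u v := by
    simp only [liftMetric_apply, map_add, map_smul, add_apply, smul_apply, smul_eq_mul]
    rw [h.symm z.1 hz.1 u.1 v.1, h.symm z.1 hz.1 _ v.1, h.symm z.1 hz.1 u.1,
      h.symm z.1 hz.1 (coordVerticalPart γ z u) (coordVerticalPart γ z v)]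
    ring
  pos z hz u hu := by
    have hnn : ∀ e, 0 ≤ γ z.1 e e := fun e => by
      by_cases he : e = 0
      · simp [he]
      · exact (h.pos z.1 hz.1 e he).le
    have key : a * liftMetric γ a b c z u u =
        γ z.1 (a • coordVerticalPart γ z u + b • u.1) (a • coordVerticalPart γ z u + b • u.1)
          + (a * (a + c) - b ^ 2) * γ z.1 u.1 u.1 := by
      simp only [liftMetric_apply, map_add, map_smul, add_apply, smul_apply, smul_eq_mul]
      rw [h.symm z.1 hz.1 (coordVerticalPart γ z u) u.1]
      ring
    refine pos_of_mul_pos_right (a := a) ?_ ha.le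
    rw [key]
    by_cases h1 : u.1 = 0
    · have hK : coordVerticalPart γ z u = u.2 := by simp [coordVerticalPart_apply, h1]
      have h2 : u.2 ≠ 0 := fun h2 => hu (Prod.ext h1 h2)
      have h3 := h.pos z.1 hz.1 u.2 h2
      rw [hK, h1]
      simp only [smul_zero, add_zero, map_smul, smul_apply, smul_eq_mul, map_zero, mul_zero]
      positivity
    · exact add_pos_of_nonneg_of_pos (hnn _) (mul_pos hα (h.pos z.1 hz.1 u.1 h1))

variable (h : IsMetricOn γ U) {z : E × E} (hz : z.1 ∈ U)
include h hz

theorem hasFDerivAt_coordVerticalPart (u : E × E) :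
    HasFDerivAt (fun z : E × E => coordVerticalPart γ z u)
      (((fderiv ℝ (christoffel γ) z.1).flip u.1).flip z.2 ∘L ContinuousLinearMap.fst ℝ E E
        + christoffel γ z.1 u.1 ∘L ContinuousLinearMap.snd ℝ E E) z := by
  have h1 := (((h.hasFDerivAt_christoffel hz).comp z hasFDerivAt_fst).clm_apply
    (hasFDerivAt_const u.1 z)).clm_apply (hasFDerivAt_snd (p := z))
  have h2 := h1.const_add u.2
  simp only [coordVerticalPart_apply]
  convert! h2 using 1
  ext w <;> simp

theorem fderiv_liftMetric (ha : 0 < a) (hα : 0 < a * (a + c) - b ^ 2) (w u v : E × E) :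
    letI dK := fun u : E × E =>
      fderiv ℝ (christoffel γ) z.1 w.1 u.1 z.2 + christoffel γ z.1 u.1 w.2
    fderiv ℝ (liftMetric γ a b c) z w u v =
      fderiv ℝ γ z.1 w.1 ((a + c) • u.1 + b • coordVerticalPart γ z u) v.1
        + γ z.1 (b • dK u) v.1
        + fderiv ℝ γ z.1 w.1 (b • u.1 + a • coordVerticalPart γ z u) (coordVerticalPart γ z v)
        + γ z.1 (a • dK u) (coordVerticalPart γ z v)
        + γ z.1 (b • u.1 + a • coordVerticalPart γ z u) (dK v) := by
  have hz' : z ∈ U ×ˢ (Set.univ : Set E) := ⟨hz, trivial⟩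
  have hK := fun u => h.hasFDerivAt_coordVerticalPart hz u
  have hγ := (h.hasFDerivAt hz).comp z hasFDerivAt_fst
  have hcon : ∀ e : E, HasFDerivAt (fun _ : E × E => e) (0 : E × E →L[ℝ] E) z :=
    fun e => hasFDerivAt_const e z
  have h1 := (((h.lift ha hα).hasFDerivAt hz').clm_apply (hasFDerivAt_const u z)).clm_apply
    (hasFDerivAt_const v z)
  have h2 := ((hγ.clm_apply ((hcon ((a + c) • u.1)).add ((hK u).const_smul b))).clm_apply
      (hcon v.1)).add
    ((hγ.clm_apply ((hcon (b • u.1)).add ((hK u).const_smul a))).clm_apply (hK v))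
  have h3 := congrArg (fun L => L w)
    ((h1.congr_of_eventuallyEq (Eventually.of_forall fun y =>
      (liftMetric_apply γ a b c y u v).symm)).unique h2)
  simp only [add_apply, ContinuousLinearMap.flip_apply, ContinuousLinearMap.comp_apply, zero_add,
    ContinuousLinearMap.comp_zero, Function.comp_apply, Pi.add_apply, Pi.smul_apply, smul_apply,
    ContinuousLinearMap.coe_fst', ContinuousLinearMap.coe_snd'] at h3
  rw [h3]
  ring

theorem smul_liftHorizontal_add_smul_liftVertical {κ : ℝ}
    (hκ : 2 * κ * (a * (a + c) - b ^ 2) = 1) (u v : E × E) :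
    (a + c) • liftHorizontal γ a b κ z u v + b • liftVertical γ a b c κ z u v =
      -(b • coordCurvature γ z.1 u.1 z.2 v.1)
        - (a / 2) • (coordCurvature γ z.1 (coordVerticalPart γ z v) z.2 u.1
          + coordCurvature γ z.1 (coordVerticalPart γ z u) z.2 v.1) := by
  have hB := h.bianchi hz u.1 z.2 v.1
  rw [coordCurvature_swap γ z.1 z.2, coordCurvature_swap γ z.1 v.1 u.1] at hB
  simp only [liftHorizontal, liftVertical]
  linear_combination (norm := module) (a * b * (a + c) * κ) • hB
    - hκ • (b • coordCurvature γ z.1 u.1 z.2 v.1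
      + (a / 2) • (coordCurvature γ z.1 (coordVerticalPart γ z v) z.2 u.1
          + coordCurvature γ z.1 (coordVerticalPart γ z u) z.2 v.1))

theorem smul_liftHorizontal_add_smul_liftVertical' {κ : ℝ}
    (hκ : 2 * κ * (a * (a + c) - b ^ 2) = 1) (u v : E × E) :
    b • liftHorizontal γ a b κ z u v + a • liftVertical γ a b c κ z u v =
      -((a / 2) • coordCurvature γ z.1 u.1 v.1 z.2) := by
  have hB := h.bianchi hz u.1 z.2 v.1
  rw [coordCurvature_swap γ z.1 z.2, coordCurvature_swap γ z.1 v.1 u.1] at hB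
  simp only [liftHorizontal, liftVertical]
  linear_combination (norm := module) (a * b ^ 2 * κ) • hB
    - hκ • ((a / 2) • coordCurvature γ z.1 u.1 v.1 z.2)

/-- The Levi-Civita connection of the lifted metric. -/
theorem christoffel_liftMetric (ha : 0 < a) (hα : 0 < a * (a + c) - b ^ 2) {κ : ℝ}
    (hκ : 2 * κ * (a * (a + c) - b ^ 2) = 1) (u v : E × E) :
    christoffel (liftMetric γ a b c) z u v = liftChristoffel γ a b c κ z u v := by
  refine (h.lift ha hα).christoffel_eq_of_symm_of_metric ⟨hz, trivial⟩ _ ?_ ?_ u v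
  · intro u v
    have hP : liftHorizontal γ a b κ z u v = liftHorizontal γ a b κ z v u := by
      simp only [liftHorizontal]; module
    have hB := h.bianchi hz u.1 z.2 v.1
    rw [coordCurvature_swap γ z.1 z.2, coordCurvature_swap γ z.1 v.1 u.1] at hB
    have hQ : liftVertical γ a b c κ z u v =
        liftVertical γ a b c κ z v u - coordCurvature γ z.1 u.1 v.1 z.2 := by
      simp only [liftVertical]
      rw [coordCurvature_swap γ z.1 v.1 u.1]
      linear_combination (norm := module) (2 * b ^ 2 * κ) • hB
        - hκ • coordCurvature γ z.1 u.1 v.1 z.2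
    simp only [liftChristoffel, hP, hQ, h.christoffel_symm hz u.1 v.1]
    refine Prod.ext rfl ?_
    simp only [coordCurvature, coordVerticalPart_apply, map_add, add_apply]
    module
  · intro w u v
    have hT : ∀ u v : E × E, liftMetric γ a b c z (liftChristoffel γ a b c κ z w u) v =
        γ z.1 ((a + c) • christoffel γ z.1 w.1 u.1
          + b • (fderiv ℝ (christoffel γ) z.1 w.1 u.1 z.2 + christoffel γ z.1 u.1 w.2
            + christoffel γ z.1 w.1 (coordVerticalPart γ z u))
          + (-(b • coordCurvature γ z.1 w.1 z.2 u.1)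
        - (a / 2) • (coordCurvature γ z.1 (coordVerticalPart γ z u) z.2 w.1
          + coordCurvature γ z.1 (coordVerticalPart γ z w) z.2 u.1))) v.1
        + γ z.1 (b • christoffel γ z.1 w.1 u.1
          + a • (fderiv ℝ (christoffel γ) z.1 w.1 u.1 z.2 + christoffel γ z.1 u.1 w.2
            + christoffel γ z.1 w.1 (coordVerticalPart γ z u))
          + -((a / 2) • coordCurvature γ z.1 w.1 u.1 z.2)) (coordVerticalPart γ z v) := by
      intro u v
      rw [liftMetric_apply, coordVerticalPart_liftChristoffel,
        ← h.smul_liftHorizontal_add_smul_liftVertical hz hκ,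
        ← h.smul_liftHorizontal_add_smul_liftVertical' hz hκ]
      simp only [liftChristoffel]
      congr 2 <;> congr 1 <;> module
    rw [(h.lift ha hα).symm z ⟨hz, trivial⟩ u, hT, hT, h.fderiv_liftMetric hz ha hα]
    simp only [h.fderiv_eq hz]
    have hS := h.inner_curvature_skew hz
    have hs := h.symm z.1 hz
    simp only [map_add, map_sub, map_neg, map_smul, add_apply, sub_apply, neg_apply, smul_apply,
      smul_eq_mul]
    set K := coordVerticalPart γ z with hKdef
    set Γ := christoffel γ z.1
    set D := fderiv ℝ (christoffel γ) z.1
    have e1 : γ z.1 (coordCurvature γ z.1 w.1 z.2 u.1) v.1 =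
        -γ z.1 (coordCurvature γ z.1 w.1 z.2 v.1) u.1 := by rw [hS, hs]
    have e2 : γ z.1 (coordCurvature γ z.1 (K w) z.2 u.1) v.1 =
        -γ z.1 (coordCurvature γ z.1 (K w) z.2 v.1) u.1 := by rw [hS, hs]
    have e3 : γ z.1 (coordCurvature γ z.1 w.1 u.1 z.2) (K v) =
        -γ z.1 (coordCurvature γ z.1 (K v) z.2 w.1) u.1 := by
      rw [h.inner_curvature_pair_symm hz, coordCurvature_swap]; simp
    have e4 : γ z.1 (coordCurvature γ z.1 w.1 v.1 z.2) (K u) =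
        -γ z.1 (coordCurvature γ z.1 (K u) z.2 w.1) v.1 := by
      rw [h.inner_curvature_pair_symm hz, coordCurvature_swap]; simp
    have s1 := hs u.1 (Γ w.1 v.1)
    have s2 := hs (K u) (Γ w.1 v.1)
    have s3 := hs u.1 (Γ w.1 (K v))
    have s4 := hs (K u) (Γ w.1 (K v))
    have s5 := hs u.1 (D w.1 v.1 z.2)
    have s6 := hs u.1 (Γ v.1 w.2)
    have s7 := hs (K u) (D w.1 v.1 z.2)
    have s8 := hs (K u) (Γ v.1 w.2)
    linear_combination b * e1 + (a / 2) * (e2 + e3 + e4) + (a + c) * s1 + b * s2 + b * s3 + a * s4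
      + b * s5 + b * s6 + a * s7 + a * s8

end IsMetricOn

end LiftedMetric

section LiftedCurvature

set_option linter.unusedSectionVars false

open Filter Topology

variable {E : Type*} [NormedAddCommGroup E] [NormedSpace ℝ E]

theorem coordCurvature_zero_left (γ : E → E →L[ℝ] E →L[ℝ] ℝ) (x v w : E) :
    coordCurvature γ x 0 v w = 0 := by simp [coordCurvature]

theorem coordCurvature_zero_right (γ : E → E →L[ℝ] E →L[ℝ] ℝ) (x u v : E) :
    coordCurvature γ x u v 0 = 0 := by simp [coordCurvature]

theorem coordCurvature_smul_right (γ : E → E →L[ℝ] E →L[ℝ] ℝ) (x u v w : E) (t : ℝ) :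
    coordCurvature γ x u v (t • w) = t • coordCurvature γ x u v w := by
  simp only [← curvatureCLM_apply, map_smul]

theorem coordCurvature_neg_right (γ : E → E →L[ℝ] E →L[ℝ] ℝ) (x u v w : E) :
    coordCurvature γ x u v (-w) = -coordCurvature γ x u v w := by
  simp only [← curvatureCLM_apply, map_neg]

variable [FiniteDimensional ℝ E] {γ : E → E →L[ℝ] E →L[ℝ] ℝ} {U : Set E} {a b c κ : ℝ}

namespace IsMetricOn

variable (h : IsMetricOn γ U) {z : E × E} (hz : z.1 ∈ U) (ha : 0 < a)
  (hα : 0 < a * (a + c) - b ^ 2) (hκ : 2 * κ * (a * (a + c) - b ^ 2) = 1)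
include h hz ha hα hκ

/-- The fibers of the tangent bundle are flat and totally geodesic. -/
theorem christoffel_lift_vertical_vertical (e e' : E) :
    christoffel (liftMetric γ a b c) z (0, e) (0, e') = 0 := by
  rw [h.christoffel_liftMetric hz ha hα hκ]
  simp [liftChristoffel, liftHorizontal, liftVertical, coordCurvature_zero_left,
    coordCurvature_zero_right]

theorem christoffel_lift_vertical_fst (u : E × E) (e : E) :
    (christoffel (liftMetric γ a b c) z u (0, e)).1 =
      -((a ^ 2 * κ) • coordCurvature γ z.1 e z.2 u.1) := by
  rw [h.christoffel_liftMetric hz ha hα hκ]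
  simp [liftChristoffel, liftHorizontal, coordCurvature_zero_left, coordCurvature_zero_right,
    coordVerticalPart_apply]

theorem fderiv_christoffel_lift_vertical_vertical (w : E × E) (e e' : E) :
    fderiv ℝ (christoffel (liftMetric γ a b c)) z w (0, e) (0, e') = 0 := by
  have h0 := (h.lift ha hα).hasFDerivAt_christoffel (x := z) ⟨hz, trivial⟩
  have h1 := (h0.clm_apply (hasFDerivAt_const ((0, e) : E × E) z)).clm_apply
    (hasFDerivAt_const ((0, e') : E × E) z)
  have h2 : (fun y => christoffel (liftMetric γ a b c) y (0, e) (0, e')) =ᶠ[𝓝 z]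
      fun _ => 0 := by
    filter_upwards [(h.lift ha hα).mem_nhds (x := z) ⟨hz, trivial⟩] with y hy
    exact h.christoffel_lift_vertical_vertical hy.1 ha hα hκ e e'
  have h3 := (h1.congr_of_eventuallyEq h2.symm).unique (hasFDerivAt_const (0 : E × E) z)
  simpa using congrArg (fun L => L w) h3

theorem fderiv_christoffel_lift_vertical_fst (u : E × E) (e e' : E) :
    (fderiv ℝ (christoffel (liftMetric γ a b c)) z (0, e) u (0, e')).1 =
      -((a ^ 2 * κ) • coordCurvature γ z.1 e' e u.1) := by
  have h0 : HasFDerivAt (christoffel (liftMetric γ a b c)) _ (z.1, z.2) :=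
    (h.lift ha hα).hasFDerivAt_christoffel (x := z) ⟨hz, trivial⟩
  have h1 := ((h0.comp z.2 (hasFDerivAt_prodMk_right z.1 z.2)).clm_apply
    (hasFDerivAt_const u z.2)).clm_apply (hasFDerivAt_const ((0, e') : E × E) z.2)
  have h2 := (hasFDerivAt_fst (𝕜 := ℝ)).comp z.2 h1
  have h3 : HasFDerivAt (fun y => -((a ^ 2 * κ) • curvatureCLM γ z.1 e' y u.1)) _ z.2 :=
    ((((curvatureCLM γ z.1 e').hasFDerivAt (x := z.2)).clm_apply
      (hasFDerivAt_const u.1 z.2)).const_smul (a ^ 2 * κ)).neg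
  have h4 := (h2.congr_of_eventuallyEq (Eventually.of_forall fun y =>
    (h.christoffel_lift_vertical_fst (z := (z.1, y)) hz ha hα hκ u e').symm)).unique h3
  simpa [curvatureCLM_apply] using congrArg (fun L => L e) h4

theorem curvature_lift_vertical (e₁ e₂ e₃ : E) :
    coordCurvature (liftMetric γ a b c) z (0, e₁) (0, e₂) (0, e₃) = 0 := by
  simp only [coordCurvature, h.fderiv_christoffel_lift_vertical_vertical hz ha hα hκ,
    h.christoffel_lift_vertical_vertical hz ha hα hκ, map_zero, sub_zero, add_zero]

theorem curvature_lift_vertical_vertical_fst (e e' : E) (u : E × E) :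
    (coordCurvature (liftMetric γ a b c) z (0, e) u (0, e')).1 =
      -((a ^ 2 * κ) • coordCurvature γ z.1 e' e u.1)
        + (a ^ 2 * κ) ^ 2 • coordCurvature γ z.1 e z.2 (coordCurvature γ z.1 e' z.2 u.1) := by
  have hz' : z ∈ U ×ˢ (Set.univ : Set E) := ⟨hz, trivial⟩
  rw [coordCurvature, h.fderiv_christoffel_lift_vertical_vertical hz ha hα hκ,
    h.christoffel_lift_vertical_vertical hz ha hα hκ, map_zero, sub_zero, sub_zero, Prod.fst_add,
    h.fderiv_christoffel_lift_vertical_fst hz ha hα hκ, (h.lift ha hα).christoffel_symm hz',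
    h.christoffel_lift_vertical_fst hz ha hα hκ, h.christoffel_lift_vertical_fst hz ha hα hκ,
    coordCurvature_neg_right, coordCurvature_smul_right]
  module

theorem curvature_lift_vertical_vertical_fst' (e e' : E) (u : E × E) :
    (coordCurvature (liftMetric γ a b c) z (0, e) (0, e') u).1 =
      (coordCurvature (liftMetric γ a b c) z (0, e) u (0, e')).1
        - (coordCurvature (liftMetric γ a b c) z (0, e') u (0, e)).1 := by
  have hB := (h.lift ha hα).bianchi (x := z) ⟨hz, trivial⟩ (0, e) (0, e') u
  rw [coordCurvature_swap _ z u] at hB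
  have h1 := congrArg Prod.fst hB
  simp only [Prod.fst_add, Prod.fst_neg, Prod.fst_zero] at h1
  linear_combination (norm := module) h1

theorem covDerivCurvature_lift_vertical (w : E × E) (e₁ e₂ e₃ : E) :
    coordCovDerivCurvature (liftMetric γ a b c) z w (0, e₁) (0, e₂) (0, e₃) =
      coordCurvature (liftMetric γ a b c) z (0, e₂)
          (christoffel (liftMetric γ a b c) z w (0, e₁)) (0, e₃)
        - coordCurvature (liftMetric γ a b c) z (0, e₁)
          (christoffel (liftMetric γ a b c) z w (0, e₂)) (0, e₃)
        - coordCurvature (liftMetric γ a b c) z (0, e₁) (0, e₂)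
          (christoffel (liftMetric γ a b c) z w (0, e₃)) := by
  have h2 : (fun y => coordCurvature (liftMetric γ a b c) y (0, e₁) (0, e₂) (0, e₃)) =ᶠ[𝓝 z]
      fun _ => 0 := by
    filter_upwards [(h.lift ha hα).mem_nhds (x := z) ⟨hz, trivial⟩] with y hy
    exact h.curvature_lift_vertical hy.1 ha hα hκ e₁ e₂ e₃
  rw [coordCovDerivCurvature, h2.fderiv_eq, h.curvature_lift_vertical hz ha hα hκ, map_zero,
    coordCurvature_swap _ z (christoffel (liftMetric γ a b c) z w (0, e₁))]
  simp

/-- A lifted metric that satisfies the pseudo-symmetry condition at `z = (x, y)` has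
`R(·, y) = 0` at `x`. -/
theorem curvature_eq_zero_of_pseudoSymmetric_lift (θ : E × E →L[ℝ] ℝ) (s : E × E)
    (hps : ∀ W X Y Z : E × E, coordCovDerivCurvature (liftMetric γ a b c) z W X Y Z =
      (2 * θ W) • coordCurvature (liftMetric γ a b c) z X Y Z
        + θ X • coordCurvature (liftMetric γ a b c) z W Y Z
        + θ Y • coordCurvature (liftMetric γ a b c) z X W Z
        + θ Z • coordCurvature (liftMetric γ a b c) z X Y W
        + liftMetric γ a b c z (coordCurvature (liftMetric γ a b c) z X Y Z) W • s) (e w : E) :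
    coordCurvature γ z.1 e z.2 w = 0 := by
  set k := a ^ 2 * κ with hk
  have hk0 : k ≠ 0 := by
    have : κ ≠ 0 := fun h0 => by simp [h0] at hκ
    positivity
  set F : E → E → E → E := fun e ξ e' => -(k • coordCurvature γ z.1 e' e ξ)
    + k ^ 2 • coordCurvature γ z.1 e z.2 (coordCurvature γ z.1 e' z.2 ξ) with hF
  set C : E → E := fun e => -(k • coordCurvature γ z.1 e z.2 w) with hC
  have key : ∀ e₁ e₂ e₃ : E,
      F e₂ (C e₁) e₃ - F e₁ (C e₂) e₃ - (F e₁ (C e₃) e₂ - F e₂ (C e₃) e₁) =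
        -(θ (0, e₁) • F e₂ w e₃) + θ (0, e₂) • F e₁ w e₃
          + θ (0, e₃) • (F e₁ w e₂ - F e₂ w e₁) := by
    intro e₁ e₂ e₃
    have h1 := congrArg Prod.fst (hps (w, 0) (0, e₁) (0, e₂) (0, e₃))
    rw [h.covDerivCurvature_lift_vertical hz ha hα hκ, h.curvature_lift_vertical hz ha hα hκ,
      coordCurvature_swap _ z (w, 0)] at h1
    simpa only [Prod.fst_sub, Prod.fst_add, Prod.fst_neg, Prod.smul_fst, map_zero, zero_apply,
      zero_smul, smul_zero, Prod.fst_zero, zero_add, add_zero, smul_neg,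
      h.curvature_lift_vertical_vertical_fst' hz ha hα hκ,
      h.curvature_lift_vertical_vertical_fst hz ha hα hκ,
      h.christoffel_lift_vertical_fst hz ha hα hκ] using h1
  have hyy : ∀ ξ, coordCurvature γ z.1 z.2 z.2 ξ = 0 := coordCurvature_self γ z.1 z.2
  have hye : ∀ e ξ, coordCurvature γ z.1 z.2 e ξ = -coordCurvature γ z.1 e z.2 ξ :=
    fun e ξ => coordCurvature_swap γ z.1 z.2 e ξ
  have hCy : C z.2 = 0 := by simp [hC, hyy]
  have hF0 : ∀ e e', F e 0 e' = 0 := fun e e' => by simp [hF, coordCurvature_zero_right]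
  have hFl : ∀ e ξ, F z.2 ξ e = -(k • coordCurvature γ z.1 e z.2 ξ) := fun e ξ => by
    simp [hF, hyy]
  have hFr : ∀ e ξ, F e ξ z.2 = k • coordCurvature γ z.1 e z.2 ξ := fun e ξ => by
    simp [hF, hyy, hye, coordCurvature_zero_right]
  have h1 := key z.2 e z.2
  simp only [hCy, hF0, hFl, hFr, hyy, smul_zero, neg_zero, sub_zero, add_zero] at h1
  by_cases hθ : θ (0, z.2) = 0
  · have h2 := key e z.2 e
    rw [hθ] at h2
    simp only [hCy, hF0, hFl, hFr, zero_smul] at h2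
    have h3 : (3 * k) • (k • coordCurvature γ z.1 e z.2 (coordCurvature γ z.1 e z.2 w)
        - θ (0, e) • coordCurvature γ z.1 e z.2 w) = 0 := by
      simp only [hC, coordCurvature_neg_right, coordCurvature_smul_right] at h2
      linear_combination (norm := module) h2
    have h4 := sub_eq_zero.1 ((smul_eq_zero.1 h3).resolve_left (by positivity))
    have h5 := congrArg (fun ξ => γ z.1 ξ w) h4
    simp only [map_smul, smul_apply, smul_eq_mul] at h5
    rw [h.inner_curvature_skew hz e z.2 (coordCurvature γ z.1 e z.2 w)] at h5
    have h6 : γ z.1 (coordCurvature γ z.1 e z.2 w) w = 0 := by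
      have := h.inner_curvature_skew hz e z.2 w w
      rw [h.symm z.1 hz w] at this
      linarith
    rw [h6, mul_zero, mul_eq_zero, neg_eq_zero] at h5
    by_contra hne
    exact (h.pos z.1 hz _ hne).ne' (h5.resolve_left hk0)
  · have h3 : (3 * k * θ (0, z.2)) • coordCurvature γ z.1 e z.2 w = 0 := by
      linear_combination (norm := module) h1
    exact (smul_eq_zero.1 h3).resolve_left (by positivity)

/-- The lift of a flat metric is flat. -/
theorem curvature_lift_eq_zero (hflat : ∀ x ∈ U, ∀ u v w, coordCurvature γ x u v w = 0)
    (u v w : E × E) : coordCurvature (liftMetric γ a b c) z u v w = 0 := by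
  have hz' : z ∈ U ×ˢ (Set.univ : Set E) := ⟨hz, trivial⟩
  have hΓ : ∀ z : E × E, z.1 ∈ U → ∀ u v, christoffel (liftMetric γ a b c) z u v =
      (christoffel γ z.1 u.1 v.1, fderiv ℝ (christoffel γ) z.1 z.2 u.1 v.1
        + christoffel γ z.1 v.1 u.2 + christoffel γ z.1 u.1 v.2) := by
    intro z hz u v
    rw [h.christoffel_liftMetric hz ha hα hκ]
    simp only [liftChristoffel, liftHorizontal, liftVertical, hflat _ hz, smul_zero, add_zero,
      sub_zero, coordVerticalPart_apply, map_add]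
    refine Prod.ext rfl ?_
    have h1 := hflat _ hz u.1 z.2 v.1
    rw [coordCurvature, h.fderiv_christoffel_symm hz u.1 z.2, h.christoffel_symm hz z.2 v.1,
      h.christoffel_symm hz z.2 (christoffel γ z.1 u.1 v.1)] at h1
    linear_combination (norm := module) h1
  have hsm := h.contDiffAt_christoffel hz
  have hc := h.hasFDerivAt_christoffel hz
  have hc2 : HasFDerivAt (fderiv ℝ (christoffel γ)) (fderiv ℝ (fderiv ℝ (christoffel γ)) z.1) z.1 :=
    ((hsm.fderiv_right (m := ∞) (by simp)).differentiableAt (by simp)).hasFDerivAt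
  have hsymm : ∀ x y, fderiv ℝ (fderiv ℝ (christoffel γ)) z.1 x y =
      fderiv ℝ (fderiv ℝ (christoffel γ)) z.1 y x := fun x y =>
    (hsm.isSymmSndFDerivAt (by simpa using ENat.LEInfty.out)) x y
  have hD : ∀ u v w : E × E, fderiv ℝ (christoffel (liftMetric γ a b c)) z u v w =
      (fderiv ℝ (christoffel γ) z.1 u.1 v.1 w.1,
        fderiv ℝ (fderiv ℝ (christoffel γ)) z.1 z.2 u.1 v.1 w.1
          + fderiv ℝ (christoffel γ) z.1 u.2 v.1 w.1 + fderiv ℝ (christoffel γ) z.1 u.1 w.1 v.2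
          + fderiv ℝ (christoffel γ) z.1 u.1 v.1 w.2) := by
    intro u v w
    have hcon : ∀ e : E, HasFDerivAt (fun _ : E × E => e) (0 : E × E →L[ℝ] E) z :=
      fun e => hasFDerivAt_const e z
    have hcz := hc.comp z hasFDerivAt_fst
    have h1 := (((h.lift ha hα).hasFDerivAt_christoffel hz').clm_apply
      (hasFDerivAt_const v z)).clm_apply (hasFDerivAt_const w z)
    have hA := fun e e' => (hcz.clm_apply (hcon e)).clm_apply (hcon e')
    have h2 := (hA v.1 w.1).prodMk ((((((hc2.comp z hasFDerivAt_fst).clm_apply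
      hasFDerivAt_snd).clm_apply (hcon v.1)).clm_apply (hcon w.1)).add (hA w.1 v.2)).add
        (hA v.1 w.2))
    have h3 : (fun y => christoffel (liftMetric γ a b c) y v w) =ᶠ[𝓝 z] fun y =>
        (christoffel γ y.1 v.1 w.1, fderiv ℝ (christoffel γ) y.1 y.2 v.1 w.1
          + christoffel γ y.1 w.1 v.2 + christoffel γ y.1 v.1 w.2) := by
      filter_upwards [(h.lift ha hα).mem_nhds hz'] with y hy using hΓ y hy.1 v w
    have h4 := congrArg (fun L => L u) ((h1.congr_of_eventuallyEq h3.symm).unique h2)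
    simp only [add_apply, ContinuousLinearMap.flip_apply, ContinuousLinearMap.comp_apply, zero_add,
      ContinuousLinearMap.comp_zero, Function.comp_apply, ContinuousLinearMap.coe_fst',
      ContinuousLinearMap.coe_snd', ContinuousLinearMap.prod_apply] at h4
    rw [h4, hsymm z.2 u.1]
    refine Prod.ext rfl ?_
    dsimp only
    abel
  have hder : fderiv ℝ (fderiv ℝ (christoffel γ)) z.1 z.2 u.1 v.1 w.1
      - fderiv ℝ (fderiv ℝ (christoffel γ)) z.1 z.2 v.1 u.1 w.1
      + (fderiv ℝ (christoffel γ) z.1 z.2 u.1 (christoffel γ z.1 v.1 w.1)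
        + christoffel γ z.1 u.1 (fderiv ℝ (christoffel γ) z.1 z.2 v.1 w.1))
      - (fderiv ℝ (christoffel γ) z.1 z.2 v.1 (christoffel γ z.1 u.1 w.1)
        + christoffel γ z.1 v.1 (fderiv ℝ (christoffel γ) z.1 z.2 u.1 w.1)) = 0 := by
    have hcon : ∀ e : E, HasFDerivAt (fun _ : E => e) (0 : E →L[ℝ] E) z.1 :=
      fun e => hasFDerivAt_const e z.1
    have hA := fun e e' => (hc.clm_apply (hcon e)).clm_apply (hcon e')
    have hB := fun e e' e'' => ((hc2.clm_apply (hcon e)).clm_apply (hcon e')).clm_apply (hcon e'')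
    have h1 := (((hB u.1 v.1 w.1).sub (hB v.1 u.1 w.1)).add
      ((hc.clm_apply (hcon u.1)).clm_apply (hA v.1 w.1))).sub
      ((hc.clm_apply (hcon v.1)).clm_apply (hA u.1 w.1))
    have h3 : (fun y => coordCurvature γ y u.1 v.1 w.1) =ᶠ[𝓝 z.1] fun _ => 0 := by
      filter_upwards [h.mem_nhds hz] with y hy using hflat y hy _ _ _
    have h4 := congrArg (fun L => L z.2)
      (((hasFDerivAt_const (0 : E) z.1).congr_of_eventuallyEq h3).unique h1)
    simp only [add_apply, sub_apply, ContinuousLinearMap.flip_apply,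
      ContinuousLinearMap.comp_apply, zero_add, ContinuousLinearMap.comp_zero,
      zero_apply] at h4
    linear_combination (norm := module) -h4
  have r1 := hflat z.1 hz u.1 v.1 w.1
  have r2 := hflat z.1 hz u.2 v.1 w.1
  have r3 := hflat z.1 hz u.1 v.2 w.1
  have r4 := hflat z.1 hz u.1 v.1 w.2
  rw [coordCurvature, hD, hD, hΓ z hz v w, hΓ z hz u w, hΓ z hz, hΓ z hz]
  refine Prod.ext r1 ?_
  simp only [coordCurvature] at r2 r3 r4
  simp only [Prod.snd_add, Prod.snd_sub, map_add, Prod.snd_zero]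
  rw [h.fderiv_christoffel_symm hz u.1 w.1 v.2, h.fderiv_christoffel_symm hz v.1 w.1 u.2,
    h.christoffel_symm hz w.1 v.2, h.christoffel_symm hz w.1 u.2,
    h.christoffel_symm hz (christoffel γ z.1 v.1 w.1) u.2,
    h.christoffel_symm hz (christoffel γ z.1 u.1 w.1) v.2]
  linear_combination (norm := module) hder + r2 + r3 + r4

end IsMetricOn

end LiftedCurvature

section Charts

set_option linter.unusedSectionVars false

open Filter Topology

variable {E : Type*} [NormedAddCommGroup E] [NormedSpace ℝ E]
  {H : Type*} [TopologicalSpace H] (I : ModelWithCorners ℝ E H) [I.Boundaryless]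
  {M : Type*} [TopologicalSpace M] [ChartedSpace H M] [IsManifold I ∞ M]

/-- The transition map from the preferred chart at `p` to the one at `q`. -/
def chartTransition (p q : M) : E → E := extChartAt I q ∘ (extChartAt I p).symm

/-- The domain of `chartTransition I p q`. -/
def transitionDomain (p q : M) : Set E := ((extChartAt I p).symm ≫ extChartAt I q).source

theorem mem_transitionDomain {p q : M} {x : E} : x ∈ transitionDomain I p q ↔
    x ∈ (extChartAt I p).target ∧ (extChartAt I p).symm x ∈ (extChartAt I q).source := by
  simp [transitionDomain, PartialEquiv.trans_source]

theorem isOpen_transitionDomain (p q : M) : IsOpen (transitionDomain I p q) := by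
  have : transitionDomain I p q =
      (extChartAt I p).target ∩ (extChartAt I p).symm ⁻¹' (extChartAt I q).source := by
    ext x; exact mem_transitionDomain I
  rw [this]
  exact (continuousOn_extChartAt_symm p).isOpen_inter_preimage (isOpen_extChartAt_target p)
    (isOpen_extChartAt_source q)

theorem contDiffAt_chartTransition {p q : M} {x : E} (hx : x ∈ transitionDomain I p q) :
    ContDiffAt ℝ ∞ (chartTransition I p q) x :=
  (contDiffOn_ext_coord_change (n := ∞) q p).contDiffAt
    ((isOpen_transitionDomain I p q).mem_nhds hx)

theorem tangentCoordChange_eq_fderiv {p q : M} {x : E} (hx : x ∈ (extChartAt I p).target) :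
    tangentCoordChange I p q ((extChartAt I p).symm x) = fderiv ℝ (chartTransition I p q) x := by
  rw [tangentCoordChange_def, I.range_eq_univ, fderivWithin_univ, (extChartAt I p).right_inv hx]
  rfl

theorem symmL_trivializationAt_eq_fderiv {p : M} {x : E} (hx : x ∈ (extChartAt I p).target) :
    (trivializationAt E (TangentSpace I) p).symmL ℝ ((extChartAt I p).symm x) =
      fderiv ℝ (chartTransition I p ((extChartAt I p).symm x)) x := by
  rw [← tangentCoordChange_eq_fderiv I hx]
  apply TangentBundle.symmL_trivializationAt_eq_core
  rw [← extChartAt_source I]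
  exact (extChartAt I p).map_target hx

theorem metricInChart_eq_fderiv {g : ∀ q : M, TangentSpace I q →L[ℝ] TangentSpace I q →L[ℝ] ℝ}
    {p : M} {x : E} (hx : x ∈ (extChartAt I p).target) (u v : E) :
    metricInChart I g p x u v = g ((extChartAt I p).symm x)
      (fderiv ℝ (chartTransition I p ((extChartAt I p).symm x)) x u)
      (fderiv ℝ (chartTransition I p ((extChartAt I p).symm x)) x v) := by
  rw [← symmL_trivializationAt_eq_fderiv I hx]
  rfl

theorem metricInChart_chartTransition
    {g : ∀ q : M, TangentSpace I q →L[ℝ] TangentSpace I q →L[ℝ] ℝ} {p q : M} {x : E}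
    (hx : x ∈ transitionDomain I p q) (u v : E) :
    metricInChart I g p x u v = metricInChart I g q (chartTransition I p q x)
      (fderiv ℝ (chartTransition I p q) x u) (fderiv ℝ (chartTransition I p q) x v) := by
  obtain ⟨hxp, hxq⟩ := (mem_transitionDomain I).1 hx
  have htq : chartTransition I p q x ∈ (extChartAt I q).target := (extChartAt I q).map_source hxq
  have hm : (extChartAt I q).symm (chartTransition I p q x) = (extChartAt I p).symm x :=
    (extChartAt I q).left_inv hxq
  rw [metricInChart_eq_fderiv I hxp, metricInChart_eq_fderiv I htq,
    ← tangentCoordChange_eq_fderiv I htq, ← tangentCoordChange_eq_fderiv I hxp,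
    ← tangentCoordChange_eq_fderiv I hxp, hm]
  have hmem : (extChartAt I p).symm x ∈ (extChartAt I p).source ∩ (extChartAt I q).source ∩
      (extChartAt I ((extChartAt I p).symm x)).source :=
    ⟨⟨(extChartAt I p).map_target hxp, hxq⟩, mem_extChartAt_source _⟩
  rw [tangentCoordChange_comp hmem, tangentCoordChange_comp hmem]

variable [FiniteDimensional ℝ E]

theorem isMetricOn_metricInChart
    (g : ContMDiffRiemannianMetric I ∞ E (fun x : M => TangentSpace I x)) (p : M) :
    IsMetricOn (metricInChart I g.inner p) (extChartAt I p).target where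
  isOpen := isOpen_extChartAt_target p
  contDiffOn := by
    refine contDiffOn_clm_apply.2 fun u => contDiffOn_clm_apply.2 fun v => ?_
    have hsec : ∀ u : E, ContMDiffOn I (I.prod 𝓘(ℝ, E)) ∞ (fun q : M => TotalSpace.mk' E
        (E := TangentSpace I) q ((trivializationAt E (TangentSpace I) p).symmL ℝ q u))
        (extChartAt I p).source := by
      intro u
      rw [extChartAt_source, ← TangentBundle.trivializationAt_baseSet (I := I)]
      refine ContMDiffOn.clm_bundle_apply (F₁ := E) (E₁ := Bundle.Trivial M E) (b := fun q : M => q)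
        (v := fun _ => u)
        (Bundle.Trivialization.contMDiffOn_symmL (trivializationAt E (TangentSpace I) p)) ?_
      intro q _
      exact (Bundle.contMDiffAt_section (F := E) (E := Bundle.Trivial M E) q).2
        contMDiffAt_const |>.contMDiffWithinAt
    have h1 : ContMDiffOn I (I.prod 𝓘(ℝ, ℝ)) ∞ (fun q : M => TotalSpace.mk' ℝ
        (E := Bundle.Trivial M ℝ) q (g.inner q
          ((trivializationAt E (TangentSpace I) p).symmL ℝ q u)
          ((trivializationAt E (TangentSpace I) p).symmL ℝ q v))) (extChartAt I p).source := by
      intro q hq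
      exact ContMDiffWithinAt.clm_bundle_apply₂ (F₁ := E) (F₂ := E)
        g.contMDiff.contMDiffAt.contMDiffWithinAt (hsec u q hq) (hsec v q hq)
    have h2 : ContMDiffOn I 𝓘(ℝ, ℝ) ∞ (fun q : M => g.inner q
          ((trivializationAt E (TangentSpace I) p).symmL ℝ q u)
          ((trivializationAt E (TangentSpace I) p).symmL ℝ q v)) (extChartAt I p).source := by
      intro q hq
      exact (contMDiffWithinAt_totalSpace.1 (h1 q hq)).2
    exact (h2.comp (contMDiffOn_extChartAt_symm p)
      fun x hx => (extChartAt I p).map_target hx).contDiffOn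
  symm x _ u v := g.symm _ _ _
  pos x hx u hu := by
    refine g.pos _ _ fun h0 => hu ?_
    have hb : (extChartAt I p).symm x ∈ (trivializationAt E (TangentSpace I) p).baseSet := by
      rw [TangentBundle.trivializationAt_baseSet, ← extChartAt_source I]
      exact (extChartAt I p).map_target hx
    have h1 : (trivializationAt E (TangentSpace I) p).symmL ℝ ((extChartAt I p).symm x) u = 0 := h0
    rw [← (trivializationAt E (TangentSpace I) p).continuousLinearMapAt_symmL (R := ℝ) hb u, h1,
      map_zero]

theorem isLocalIsometryAt_chartTransition
    (g : ∀ q : M, TangentSpace I q →L[ℝ] TangentSpace I q →L[ℝ] ℝ) {p q : M} {x : E}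
    (hx : x ∈ transitionDomain I p q) :
    IsLocalIsometryAt (metricInChart I g p) (metricInChart I g q) (extChartAt I p).target
      (extChartAt I q).target (chartTransition I p q) x := by
  filter_upwards [(isOpen_transitionDomain I p q).mem_nhds hx] with y hy
  obtain ⟨hyp, hyq⟩ := (mem_transitionDomain I).1 hy
  exact ⟨hyp, (extChartAt I q).map_source hyq, contDiffAt_chartTransition I hy,
    metricInChart_chartTransition I hy⟩

theorem mem_transitionDomain_self {p : M} {x : E} (hx : x ∈ (extChartAt I p).target) :
    x ∈ transitionDomain I p ((extChartAt I p).symm x) :=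
  (mem_transitionDomain I).2 ⟨hx, mem_extChartAt_source _⟩

/-- A flat manifold has vanishing curvature tensor at all points of each chart. -/
theorem IsFlat.coordCurvature_eq_zero
    {g : ContMDiffRiemannianMetric I ∞ E (fun x : M => TangentSpace I x)}
    (hflat : IsFlat I g.inner) (p : M) (x : E) (hx : x ∈ (extChartAt I p).target) (u v w : E) :
    coordCurvature (metricInChart I g.inner p) x u v w = 0 := by
  have hφ := isLocalIsometryAt_chartTransition I g.inner (mem_transitionDomain_self I hx)
  have h := isMetricOn_metricInChart I g
  refine hφ.injective (h p) ?_
  rw [map_zero, hφ.map_curvature (h _) (h _)]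
  exact hflat ((extChartAt I p).symm x) _ _ _

end Charts

section TangentBundleCharts

set_option linter.unusedSectionVars false

open Filter Topology

variable {E : Type*} [NormedAddCommGroup E] [NormedSpace ℝ E] [FiniteDimensional ℝ E]
  {H : Type*} [TopologicalSpace H] (I : ModelWithCorners ℝ E H) [I.Boundaryless]
  {M : Type*} [TopologicalSpace M] [ChartedSpace H M] [IsManifold I ∞ M]

theorem extChartAt_tangent_apply (v w : TangentBundle I M) :
    extChartAt I.tangent v w =
      (extChartAt I v.proj w.proj, tangentCoordChange I w.proj v.proj w.proj w.snd) := rfl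

theorem extChartAt_tangent_symm_apply (v : TangentBundle I M) (z : E × E) :
    (extChartAt I.tangent v).symm z = ⟨(extChartAt I v.proj).symm z.1,
      tangentCoordChange I v.proj ((extChartAt I v.proj).symm z.1)
        ((extChartAt I v.proj).symm z.1) z.2⟩ := rfl

theorem mem_extChartAt_tangent_target (v : TangentBundle I M) (z : E × E) :
    z ∈ (extChartAt I.tangent v).target ↔ z.1 ∈ (extChartAt I v.proj).target := by
  rw [extChartAt_target, extChartAt_target, I.tangent.range_eq_univ, I.range_eq_univ,
    Set.inter_univ, Set.inter_univ]
  exact TangentBundle.mem_chart_target_iff (I := I) (I.tangent.symm z) v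

theorem extChartAt_tangent_self (v : TangentBundle I M) :
    extChartAt I.tangent v v = (extChartAt I v.proj v.proj, v.snd) :=
  Prod.ext rfl (tangentCoordChange_self (mem_extChartAt_source v.proj))

/-- The transition maps of the tangent bundle are the differentials of those of the base. -/
theorem chartTransition_tangent (v w : TangentBundle I M) {z : E × E}
    (hz : z.1 ∈ transitionDomain I v.proj w.proj) :
    chartTransition I.tangent v w z =
      (chartTransition I v.proj w.proj z.1,
        fderiv ℝ (chartTransition I v.proj w.proj) z.1 z.2) := by
  obtain ⟨h1, h2⟩ := (mem_transitionDomain I).1 hz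
  rw [chartTransition, Function.comp_apply, extChartAt_tangent_symm_apply,
    extChartAt_tangent_apply]
  refine Prod.ext rfl ?_
  dsimp only
  rw [tangentCoordChange_comp ⟨⟨(extChartAt I v.proj).map_target h1, mem_extChartAt_source _⟩, h2⟩,
    tangentCoordChange_eq_fderiv I h1]

theorem fderiv_chartTransition_tangent (v w : TangentBundle I M) {z : E × E}
    (hz : z.1 ∈ transitionDomain I v.proj w.proj) (u : E × E) :
    fderiv ℝ (chartTransition I.tangent v w) z u =
      (fderiv ℝ (chartTransition I v.proj w.proj) z.1 u.1,
        fderiv ℝ (fderiv ℝ (chartTransition I v.proj w.proj)) z.1 u.1 z.2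
          + fderiv ℝ (chartTransition I v.proj w.proj) z.1 u.2) := by
  have hsm := contDiffAt_chartTransition I hz
  have h1 := ((hsm.differentiableAt (by simp)).hasFDerivAt.comp z hasFDerivAt_fst).prodMk
    ((hsm.hasFDerivAt_fderiv.comp z hasFDerivAt_fst).clm_apply hasFDerivAt_snd)
  have h2 : chartTransition I.tangent v w =ᶠ[𝓝 z] fun z =>
      (chartTransition I v.proj w.proj z.1,
        fderiv ℝ (chartTransition I v.proj w.proj) z.1 z.2) := by
    filter_upwards [((isOpen_transitionDomain I v.proj w.proj).preimage continuous_fst).mem_nhds hz]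
      with y hy using chartTransition_tangent I v w hy
  rw [(h1.congr_of_eventuallyEq h2).fderiv]
  simp [add_comm]

/-- The `g`-natural metric in the charts of the tangent bundle. -/
theorem metricInChart_gNaturalMetric
    (g : ContMDiffRiemannianMetric I ∞ E (fun x : M => TangentSpace I x)) (a b c : ℝ)
    (v : TangentBundle I M) {z : E × E} (hz : z.1 ∈ (extChartAt I v.proj).target) :
    metricInChart I.tangent (gNaturalMetric I g.inner a b c) v z =
      liftMetric (metricInChart I g.inner v.proj) a b c z := by
  set m := (extChartAt I v.proj).symm z.1 with hm
  set φ := chartTransition I v.proj m with hφ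
  set y : E := fderiv ℝ φ z.1 z.2 with hy
  have hdom : z.1 ∈ transitionDomain I v.proj m := mem_transitionDomain_self I hz
  have hzt := (mem_extChartAt_tangent_target I v z).2 hz
  have hv' : (extChartAt I.tangent v).symm z = ⟨m, y⟩ := by
    rw [extChartAt_tangent_symm_apply, tangentCoordChange_eq_fderiv I hz]
  have hiso := isLocalIsometryAt_chartTransition I g.inner hdom
  have hM := isMetricOn_metricInChart I g
  have hK : ∀ u : E × E, fderiv ℝ (fderiv ℝ φ) z.1 u.1 z.2 + fderiv ℝ φ z.1 u.2
      + christoffelAt I g.inner m (fderiv ℝ φ z.1 u.1) y =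
      fderiv ℝ φ z.1 (coordVerticalPart (metricInChart I g.inner v.proj) z u) := by
    intro u
    rw [coordVerticalPart_apply, map_add, hiso.map_christoffel (hM _) (hM _)]
    have hpt : φ z.1 = extChartAt I m m := rfl
    rw [christoffelAt, ← hpt]
    abel
  refine ContinuousLinearMap.ext fun u => ContinuousLinearMap.ext fun w => ?_
  rw [metricInChart_eq_fderiv I.tangent hzt]
  rw [hv']
  rw [fderiv_chartTransition_tangent I v ⟨m, y⟩ hdom, fderiv_chartTransition_tangent I v ⟨m, y⟩ hdom]
  have hG : ∀ p q : E × E, gNaturalMetric I g.inner a b c ⟨m, y⟩ p q =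
      a * (g.inner m p.1 q.1 + g.inner m (p.2 + christoffelAt I g.inner m p.1 y)
          (q.2 + christoffelAt I g.inner m q.1 y))
        + b * (g.inner m p.1 (q.2 + christoffelAt I g.inner m q.1 y)
          + g.inner m (p.2 + christoffelAt I g.inner m p.1 y) q.1)
        + c * g.inner m p.1 q.1 := fun p q => rfl
  have hL : liftMetric (metricInChart I g.inner v.proj) a b c z u w =
      a * (metricInChart I g.inner v.proj z.1 u.1 w.1
          + metricInChart I g.inner v.proj z.1
            (coordVerticalPart (metricInChart I g.inner v.proj) z u)
            (coordVerticalPart (metricInChart I g.inner v.proj) z w))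
        + b * (metricInChart I g.inner v.proj z.1 u.1
            (coordVerticalPart (metricInChart I g.inner v.proj) z w)
          + metricInChart I g.inner v.proj z.1
            (coordVerticalPart (metricInChart I g.inner v.proj) z u) w.1)
        + c * metricInChart I g.inner v.proj z.1 u.1 w.1 := rfl
  rw [hG, hL]
  simp only [metricInChart_eq_fderiv I hz]
  simp only [← hm, ← hφ]
  erw [hK, hK]

end TangentBundleCharts

section PseudoSymmetric

set_option linter.unusedSectionVars false

open Filter Topology

variable {E : Type*} [NormedAddCommGroup E] [NormedSpace ℝ E] [FiniteDimensional ℝ E]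
  {H : Type*} [TopologicalSpace H] (I : ModelWithCorners ℝ E H) [I.Boundaryless]
  {M : Type*} [TopologicalSpace M] [ChartedSpace H M] [IsManifold I ∞ M]
  (g : ContMDiffRiemannianMetric I ∞ E (fun x : M => TangentSpace I x)) {a b c : ℝ}

theorem metricInChart_gNaturalMetric_eventuallyEq (v : TangentBundle I M) :
    metricInChart I.tangent (gNaturalMetric I g.inner a b c) v
      =ᶠ[𝓝 (extChartAt I.tangent v v)] liftMetric (metricInChart I g.inner v.proj) a b c := by
  filter_upwards [extChartAt_target_mem_nhds (I := I.tangent) v] with z hz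
  exact metricInChart_gNaturalMetric I g a b c v ((mem_extChartAt_tangent_target I v z).1 hz)

theorem exists_two_mul_mul_eq_one {α : ℝ} (hα : 0 < α) : ∃ κ : ℝ, 2 * κ * α = 1 :=
  ⟨(2 * α)⁻¹, by field_simp⟩

theorem isFlat_of_isPseudoSymmetric_gNaturalMetric (ha : 0 < a)
    (hα : 0 < a * (a + c) - b ^ 2)
    (hps : IsPseudoSymmetric I.tangent (gNaturalMetric I g.inner a b c)) :
    IsFlat I g.inner := by
  obtain ⟨θ, -, hθ⟩ := hps
  obtain ⟨κ, hκ⟩ := exists_two_mul_mul_eq_one hα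
  intro p u v w
  set V : TangentBundle I M := ⟨p, v⟩
  have hV : extChartAt I.tangent V V = (extChartAt I p p, (v : E)) := extChartAt_tangent_self I V
  have hev := metricInChart_gNaturalMetric_eventuallyEq I g (a := a) (b := b) (c := c) V
  have hGV : gNaturalMetric I g.inner a b c V =
      liftMetric (metricInChart I g.inner p) a b c (extChartAt I.tangent V V) := by
    have h1 := hev.eq_of_nhds
    rw [← h1]
    refine ContinuousLinearMap.ext fun X => ContinuousLinearMap.ext fun Y => ?_
    have h2 : (trivializationAt (E × E) (TangentSpace I.tangent) V).symmL ℝ V =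
        ContinuousLinearMap.id ℝ (E × E) := by
      rw [TangentBundle.symmL_trivializationAt_eq_core (mem_chart_source _ V)]
      exact ContinuousLinearMap.ext fun X => tangentCoordChange_self (mem_extChartAt_source V)
    rw [metricInChart, (extChartAt I.tangent V).left_inv (mem_extChartAt_source V), h2]
    rfl
  have hR := (coordCurvature_congr hev).eq_of_nhds
  have hD := coordCovDerivCurvature_congr hev
  rw [hV] at hR hD hGV
  refine (isMetricOn_metricInChart I g p).curvature_eq_zero_of_pseudoSymmetric_lift
    (z := (extChartAt I p p, (v : E))) (mem_extChartAt_target p) ha hα hκ (θ V)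
    (sharp I.tangent (gNaturalMetric I g.inner a b c) V (θ V)) ?_ u w
  intro W X Y Z
  have h := hθ V W X Y Z
  simp only [covDerivCurvatureAt, curvatureAt] at h
  rw [hV, hR, hD, hGV] at h
  exact h

theorem eventually_coordCurvature_gNaturalMetric_eq_zero (ha : 0 < a)
    (hα : 0 < a * (a + c) - b ^ 2) (hflat : IsFlat I g.inner) (v : TangentBundle I M) :
    ∀ᶠ z in 𝓝 (extChartAt I.tangent v v), ∀ X Y Z, coordCurvature
      (metricInChart I.tangent (gNaturalMetric I g.inner a b c) v) z X Y Z = 0 := by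
  obtain ⟨κ, hκ⟩ := exists_two_mul_mul_eq_one hα
  filter_upwards [coordCurvature_congr (metricInChart_gNaturalMetric_eventuallyEq I g v),
    extChartAt_target_mem_nhds (I := I.tangent) v] with z h1 hz X Y Z
  rw [h1]
  exact (isMetricOn_metricInChart I g v.proj).curvature_lift_eq_zero
    ((mem_extChartAt_tangent_target I v z).1 hz) ha hα hκ
    (hflat.coordCurvature_eq_zero I v.proj) X Y Z

theorem isFlat_gNaturalMetric (ha : 0 < a) (hα : 0 < a * (a + c) - b ^ 2)
    (hflat : IsFlat I g.inner) : IsFlat I.tangent (gNaturalMetric I g.inner a b c) :=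
  fun v X Y Z =>
    (eventually_coordCurvature_gNaturalMetric_eq_zero I g ha hα hflat v).self_of_nhds X Y Z

theorem isPseudoSymmetric_gNaturalMetric (ha : 0 < a) (hα : 0 < a * (a + c) - b ^ 2)
    (hflat : IsFlat I g.inner) :
    IsPseudoSymmetric I.tangent (gNaturalMetric I g.inner a b c) := by
  refine ⟨fun _ => 0, ?_, fun v W X Y Z => ?_⟩
  · exact Bundle.contMDiff_zeroSection ℝ
      (fun q : TangentBundle I M => TangentSpace I.tangent q →L[ℝ] Bundle.Trivial _ ℝ q)
  · have hR := isFlat_gNaturalMetric I g ha hα hflat v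
    have hD : covDerivCurvatureAt I.tangent (gNaturalMetric I g.inner a b c) v W X Y Z = 0 :=
      coordCovDerivCurvature_eq_zero
        (eventually_coordCurvature_gNaturalMetric_eq_zero I g ha hα hflat v) W X Y Z
    rw [hD]
    simp [hR]

end PseudoSymmetric

end

theorem stmt_8 (n : ℕ) (hn : 3 ≤ n) {M : Type*} [TopologicalSpace M]
    [ChartedSpace (EuclideanSpace ℝ (Fin n)) M] [IsManifold (𝓡 n) ∞ M]
    (g : ContMDiffRiemannianMetric (𝓡 n) ∞ (EuclideanSpace ℝ (Fin n))
      (fun x : M => TangentSpace (𝓡 n) x))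
    (a b c : ℝ) (ha : 0 < a) (hα : 0 < a * (a + c) - b ^ 2) :
    (IsPseudoSymmetric (𝓡 n).tangent (gNaturalMetric (𝓡 n) g.inner a b c) ↔
        IsFlat (𝓡 n) g.inner) ∧
      (IsPseudoSymmetric (𝓡 n).tangent (gNaturalMetric (𝓡 n) g.inner a b c) →
        IsFlat (𝓡 n).tangent (gNaturalMetric (𝓡 n) g.inner a b c)) :=
  ⟨⟨isFlat_of_isPseudoSymmetric_gNaturalMetric (𝓡 n) g ha hα,
    isPseudoSymmetric_gNaturalMetric (𝓡 n) g ha hα⟩,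
    fun h => isFlat_gNaturalMetric (𝓡 n) g ha hα
      (isFlat_of_isPseudoSymmetric_gNaturalMetric (𝓡 n) g ha hα h)⟩
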